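/- arXiv:2404.00542 — 4 statements merged into one kernel-verified Lean document; each statement's English description precedes it below -/
import Mathlib

section
/- Let X and Y be σ-compact metrizable spaces, let D_p denote either C_p or C_p* (the same choice for both X and Y), and let T: D_p(X) → D_p(Y) be a uniformly continuous surjection that is c-good for some c > 0. If all finite powers of X are weakly infinite-dimensional (respectively, all finite powers of X are (m-C)-spaces for a fixed m ≥ 2), then all finite powers of Y are weakly infinite-dimensional (respectively, (m-C)-spaces). -/
open Set Topology TopologicalSpace

/-- `C(X)` as a set of functions. -/
def CpSet (X : Type*) [TopologicalSpace X] : Set (X → ℝ) := {f | Continuous f}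

/-- `C*(X)` as a set of functions. -/
def CpStarSet (X : Type*) [TopologicalSpace X] : Set (X → ℝ) :=
  {f | Continuous f ∧ ∃ M, ∀ x, |f x| ≤ M}

/-- Uniform continuity of a map between function spaces with the pointwise topology. -/
def IsUnifContPt {X Y : Type*} (EX : Set (X → ℝ)) (EY : Set (Y → ℝ))
    (φ : EX → EY) : Prop :=
  ∀ U ∈ nhds (0 : Y → ℝ), ∃ V ∈ nhds (0 : X → ℝ),
    ∀ f g : EX, (f : X → ℝ) - g ∈ V → (φ f : Y → ℝ) - φ g ∈ U

noncomputable def supNorm {X : Type*} (f : X → ℝ) : ℝ := ⨆ x, |f x|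

def IsCGood {X Y : Type*} {EX : Set (X → ℝ)} {EY : Set (Y → ℝ)}
    (c : ℝ) (φ : EX → EY) : Prop :=
  ∀ g : EY, (∃ M, ∀ y, |(g : Y → ℝ) y| ≤ M) →
    ∃ f : EX, φ f = g ∧ (∃ M, ∀ x, |(f : X → ℝ) x| ≤ M) ∧
      supNorm (f : X → ℝ) ≤ c * supNorm (g : Y → ℝ)

/-- `L` is a partition between `A` and `B`. -/
def IsPartitionBetween {X : Type*} [TopologicalSpace X] (L A B : Set X) : Prop :=
  IsClosed L ∧ ∃ U V : Set X, IsOpen U ∧ IsOpen V ∧ Disjoint U V ∧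
    A ⊆ U ∧ B ⊆ V ∧ Lᶜ = U ∪ V

/-- Weakly infinite-dimensional space. -/
def IsWID (X : Type*) [TopologicalSpace X] : Prop :=
  ∀ A B : ℕ → Set X,
    (∀ i, IsClosed (A i)) → (∀ i, IsClosed (B i)) → (∀ i, Disjoint (A i) (B i)) →
    ∃ L : ℕ → Set X, (∀ i, IsPartitionBetween (L i) (A i) (B i)) ∧ (⋂ i, L i) = ∅

/-- `(m-C)`-space in the sense of Fedorchuk. -/
def IsMCSpace (m : ℕ) (X : Type*) [TopologicalSpace X] : Prop :=
  ∀ G : ℕ → Fin m → Set X, (∀ i j, IsOpen (G i j)) → (∀ i, (⋃ j, G i j) = Set.univ) →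
    ∃ H : ℕ → Set (Set X),
      (∀ i, ∀ W ∈ H i, IsOpen W) ∧
      (∀ i, (H i).Pairwise Disjoint) ∧
      (∀ i, ∀ W ∈ H i, ∃ j, W ⊆ G i j) ∧
      (⋃ i, ⋃₀ H i) = Set.univ

/-- Relative version of the `(m-C)`-property of a subset `A` of `Z`, with the disjoint families
indexed by the elements of the covers they refine. -/
def RelMC (m : ℕ) {Z : Type*} [TopologicalSpace Z] (A : Set Z) : Prop :=
  ∀ G : ℕ → Fin m → Set Z, (∀ i j, IsOpen (G i j)) → (∀ i, A ⊆ ⋃ j, G i j) →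
    ∃ H : ℕ → Fin m → Set Z, (∀ i j, IsOpen (H i j)) ∧ (∀ i j, H i j ⊆ G i j) ∧
      (∀ i, Pairwise fun j k => Disjoint (H i j) (H i k)) ∧ A ⊆ ⋃ i, ⋃ j, H i j

section RelMC

variable {Z W : Type*} [TopologicalSpace Z] [TopologicalSpace W] {m : ℕ}

lemma IsMCSpace.relMC_univ [NeZero m] (h : IsMCSpace m Z) : RelMC m (univ : Set Z) := by
  intro G hG hcov
  obtain ⟨H, hHo, hHd, hHr, hHc⟩ := h G hG fun i => univ_subset_iff.1 (hcov i)
  choose! j hj using hHr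
  refine ⟨fun i k => ⋃₀ {W | W ∈ H i ∧ j i W = k}, fun i k => ?_, fun i k => ?_,
    fun i k l hkl => ?_, ?_⟩
  · exact isOpen_sUnion fun W hW => hHo i W hW.1
  · exact sUnion_subset fun W hW => hW.2 ▸ hj i W hW.1
  · simp only [disjoint_sUnion_left, disjoint_sUnion_right]
    rintro W ⟨hW, rfl⟩ V ⟨hV, rfl⟩
    exact hHd i hV hW (by rintro rfl; exact hkl rfl)
  · intro z _
    have hz : z ∈ ⋃ i, ⋃₀ H i := hHc ▸ mem_univ z
    obtain ⟨i, W, hW, hzW⟩ := mem_iUnion.1 hz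
    exact mem_iUnion.2 ⟨i, mem_iUnion.2 ⟨j i W, W, ⟨hW, rfl⟩, hzW⟩⟩

lemma RelMC.isMCSpace (h : RelMC m (univ : Set Z)) : IsMCSpace m Z := by
  intro G hG hcov
  obtain ⟨H, hHo, hHr, hHd, hHc⟩ := h G hG fun i => (hcov i).ge
  refine ⟨fun i => range (H i), ?_, ?_, ?_, ?_⟩
  · rintro i _ ⟨j, rfl⟩
    exact hHo i j
  · rintro i _ ⟨j, rfl⟩ _ ⟨k, rfl⟩ hne
    exact hHd i (by rintro rfl; exact hne rfl)
  · rintro i _ ⟨j, rfl⟩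
    exact ⟨j, hHr i j⟩
  · simpa only [sUnion_range] using univ_subset_iff.1 hHc

lemma relMC_empty : RelMC m (∅ : Set Z) := fun _ _ _ =>
  ⟨fun _ _ => ∅, fun _ _ => isOpen_empty, fun _ _ => empty_subset _,
    fun _ _ _ _ => disjoint_empty _, empty_subset _⟩

lemma RelMC.mono_of_isClosed [NeZero m] {A B : Set Z} (hA : RelMC m A) (hB : IsClosed B) (hBA : B ⊆ A) :
    RelMC m B := by
  intro G hG hcov
  obtain ⟨H, hHo, hHr, hHd, hHc⟩ := hA (fun i j => G i j ∪ Bᶜ)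
    (fun i j => (hG i j).union hB.isOpen_compl) (fun i z hz => by
      by_cases hzB : z ∈ B
      · obtain ⟨j, hj⟩ := mem_iUnion.1 (hcov i hzB)
        exact mem_iUnion.2 ⟨j, Or.inl hj⟩
      · exact mem_iUnion.2 ⟨0, Or.inr hzB⟩)
  refine ⟨fun i j => H i j ∩ G i j, fun i j => (hHo i j).inter (hG i j),
    fun i j => inter_subset_right, fun i j k hjk =>
      (hHd i hjk).mono inter_subset_left inter_subset_left, fun z hz => ?_⟩
  obtain ⟨i, hi⟩ := mem_iUnion.1 (hHc (hBA hz))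
  obtain ⟨j, hj⟩ := mem_iUnion.1 hi
  exact mem_iUnion.2 ⟨i, mem_iUnion.2 ⟨j, hj, (hHr i j hj).resolve_right fun h => h hz⟩⟩

lemma RelMC.iUnion_nat {A : ℕ → Set Z} (hA : ∀ k, RelMC m (A k)) : RelMC m (⋃ k, A k) := by
  intro G hG hcov
  choose H hHo hHr hHd hHc using fun k => hA k (fun i => G (Nat.pair k i)) (fun i j => hG _ j)
    fun i => (subset_iUnion A k).trans (hcov _)
  refine ⟨fun n => H n.unpair.1 n.unpair.2, fun n j => hHo _ _ j, fun n j => ?_,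
    fun n => hHd _ _, fun z hz => ?_⟩
  · simpa using hHr n.unpair.1 n.unpair.2 j
  · obtain ⟨k, hk⟩ := mem_iUnion.1 hz
    obtain ⟨i, hi⟩ := mem_iUnion.1 (hHc k hk)
    exact mem_iUnion.2 ⟨Nat.pair k i, by simpa using hi⟩

lemma RelMC.iUnion {ι : Sort*} [Countable ι] {A : ι → Set Z} (hA : ∀ k, RelMC m (A k)) :
    RelMC m (⋃ k, A k) := by
  cases isEmpty_or_nonempty ι
  · rw [iUnion_of_empty]
    exact relMC_empty
  · obtain ⟨e, he⟩ := exists_surjective_nat ι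
    rw [← he.iUnion_comp]
    exact RelMC.iUnion_nat fun k => hA (e k)

lemma RelMC.of_disjoint_closed {A C : Set Z} (hA : RelMC m A) (hAC : A ⊆ C)
    (h : ∀ R, IsClosed R → Disjoint R A → RelMC m (C ∩ R)) : RelMC m C := by
  intro G hG hcov
  obtain ⟨H, hHo, hHr, hHd, hHc⟩ := hA (fun i => G (2 * i)) (fun i => hG _)
    fun i => hAC.trans (hcov _)
  obtain ⟨K, hKo, hKr, hKd, hKc⟩ := h (⋃ i, ⋃ j, H i j)ᶜ
    (isOpen_iUnion fun i => isOpen_iUnion fun j => hHo i j).isClosed_compl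
    (disjoint_compl_left_iff_subset.2 hHc) (fun i => G (2 * i + 1)) (fun i => hG _)
    fun i => inter_subset_left.trans (hcov _)
  have key : ∀ n, ∃ L : Fin m → Set Z, (∀ j, IsOpen (L j)) ∧ (∀ j, L j ⊆ G n j) ∧
      (Pairwise fun j k => Disjoint (L j) (L k)) ∧ (∀ i, n = 2 * i → L = H i) ∧
      ∀ i, n = 2 * i + 1 → L = K i := by
    intro n
    rcases Nat.even_or_odd' n with ⟨i, rfl | rfl⟩
    · refine ⟨H i, hHo i, hHr i, hHd i, fun k hk => ?_, fun k hk => by omega⟩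
      rw [show i = k by omega]
    · refine ⟨K i, hKo i, hKr i, hKd i, fun k hk => by omega, fun k hk => ?_⟩
      rw [show i = k by omega]
  choose L hLo hLr hLd hLH hLK using key
  refine ⟨L, hLo, hLr, hLd, fun z hz => ?_⟩
  by_cases hzH : z ∈ ⋃ i, ⋃ j, H i j
  · obtain ⟨i, hi⟩ := mem_iUnion.1 hzH
    exact mem_iUnion.2 ⟨2 * i, by rwa [hLH _ i rfl]⟩
  · obtain ⟨i, hi⟩ := mem_iUnion.1 (hKc ⟨hz, hzH⟩)
    exact mem_iUnion.2 ⟨2 * i + 1, by rwa [hLK _ i rfl]⟩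

/-- Relatively disjoint open sets extend to disjoint open sets. -/
lemma exists_disjoint_open_extension [MetrizableSpace Z] {ι : Type*} (C : Set Z) (O : ι → Set Z)
    (hO : ∀ j, IsOpen (O j)) (hd : Pairwise fun j k => Disjoint (C ∩ O j) (C ∩ O k)) :
    ∃ V : ι → Set Z, (∀ j, IsOpen (V j)) ∧ (Pairwise fun j k => Disjoint (V j) (V k)) ∧
      ∀ j, C ∩ O j ⊆ V j := by
  let _ := metrizableSpaceMetric Z
  refine ⟨fun j => {z | Metric.infEDist z (C ∩ O j) < Metric.infEDist z (C \ O j)}, fun j => ?_,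
    fun j k hjk => ?_, fun j z hz => ?_⟩
  · exact isOpen_lt Metric.continuous_infEDist Metric.continuous_infEDist
  · have hsub : ∀ j k, j ≠ k → C ∩ O k ⊆ C \ O j := fun j k hjk z hz =>
      ⟨hz.1, fun hj => Set.disjoint_left.1 (hd hjk) ⟨hz.1, hj⟩ hz⟩
    refine Set.disjoint_left.2 fun z hj hk => ?_
    exact lt_irrefl _ (((hj.trans_le (Metric.infEDist_anti (hsub j k hjk))).trans hk).trans_le
      (Metric.infEDist_anti (hsub k j hjk.symm)))
  · show Metric.infEDist z (C ∩ O j) < Metric.infEDist z (C \ O j)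
    rw [Metric.infEDist_zero_of_mem hz, Metric.infEDist_pos_iff_notMem_closure]
    intro hcl
    exact closure_minimal (t := (O j)ᶜ) (fun w hw => hw.2) (hO j).isClosed_compl hcl hz.2

lemma RelMC.of_injOn [MetrizableSpace Z] [T2Space W] {C : Set Z} (hC : IsCompact C) {f : Z → W}
    (hf : ContinuousOn f C) (hinj : InjOn f C) (h : RelMC m (f '' C)) : RelMC m C := by
  intro G hG hcov
  obtain ⟨H, hHo, hHr, hHd, hHc⟩ := h (fun i j => (f '' (C \ G i j))ᶜ)
    (fun i j => ((hC.diff (hG i j)).image_of_continuousOn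
      (hf.mono sdiff_subset)).isClosed.isOpen_compl) (by
      rintro i _ ⟨z, hz, rfl⟩
      obtain ⟨j, hj⟩ := mem_iUnion.1 (hcov i hz)
      refine mem_iUnion.2 ⟨j, ?_⟩
      rintro ⟨w, hw, hwz⟩
      exact hw.2 (hinj hw.1 hz hwz ▸ hj))
  choose O hO hOH using fun i j => continuousOn_iff'.1 hf _ (hHo i j)
  have hOH' : ∀ i j z, z ∈ C → (z ∈ O i j ↔ f z ∈ H i j) := fun i j z hz => by
    have : z ∈ f ⁻¹' H i j ∩ C ↔ z ∈ O i j ∩ C := by rw [hOH]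
    simpa [hz] using this.symm
  choose V hVo hVd hVO using fun i => exists_disjoint_open_extension C (O i) (hO i)
    (fun j k hjk => Set.disjoint_left.2 fun z hj hk => Set.disjoint_left.1 (hHd i hjk)
      ((hOH' i j z hj.1).1 hj.2) ((hOH' i k z hj.1).1 hk.2))
  refine ⟨fun i j => V i j ∩ G i j, fun i j => (hVo i j).inter (hG i j),
    fun i j => inter_subset_right, fun i j k hjk =>
      (hVd i hjk).mono inter_subset_left inter_subset_left, fun z hz => ?_⟩
  obtain ⟨i, hi⟩ := mem_iUnion.1 (hHc (mem_image_of_mem f hz))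
  obtain ⟨j, hj⟩ := mem_iUnion.1 hi
  refine mem_iUnion.2 ⟨i, mem_iUnion.2 ⟨j, hVO i j ⟨hz, (hOH' i j z hz).2 hj⟩, ?_⟩⟩
  by_contra hzG
  exact hHr i j hj ⟨z, ⟨hz, hzG⟩, rfl⟩

/-- The fibres of `f` on `C` have at most `N` points. -/
def FibersLE {Z W : Type*} (f : Z → W) (C : Set Z) (N : ℕ) : Prop :=
  ∀ t : Finset Z, ↑t ⊆ C → (∀ z ∈ t, ∀ w ∈ t, f z = f w) → t.card ≤ N

lemma RelMC.of_fibersLE [NeZero m] [MetrizableSpace Z] [SecondCountableTopology Z] [T2Space W]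
    (hW : RelMC m (univ : Set W)) (N : ℕ) {C : Set Z} (hC : IsCompact C) {f : Z → W}
    (hf : ContinuousOn f C) (hN : FibersLE f C N) : RelMC m C := by
  induction N generalizing C with
  | zero =>
    have : C = ∅ := by
      refine eq_empty_of_forall_notMem fun z hz => ?_
      have := hN {z} (by simpa using hz) (by simp)
      simp at this
    exact this ▸ relMC_empty
  | succ N ih =>
    classical
    let ι := {B : countableBasis Z × countableBasis Z //
      Disjoint (closure (B.1 : Set Z)) (closure (B.2 : Set Z))}
    let A : ι → Set Z := fun B =>
      (C ∩ closure (B.1.1 : Set Z)) ∩ f ⁻¹' (f '' (C ∩ closure (B.1.2 : Set Z)))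
    have hAC : ∀ B, A B ⊆ C := fun B z hz => hz.1.1
    have hA : ∀ B, RelMC m (A B) := by
      intro B
      refine ih ?_ (hf.mono (hAC B)) ?_
      · have hcl : IsClosed (f '' (C ∩ closure (B.1.2 : Set Z))) :=
          ((hC.inter_right isClosed_closure).image_of_continuousOn
            (hf.mono inter_subset_left)).isClosed
        obtain ⟨u, hu, hu'⟩ := continuousOn_iff_isClosed.1 hf _ hcl
        have : A B = (C ∩ closure (B.1.1 : Set Z)) ∩ u := by
          ext z
          have : z ∈ f ⁻¹' (f '' (C ∩ closure (B.1.2 : Set Z))) ∩ C ↔ z ∈ u ∩ C := by rw [hu']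
          simp only [mem_inter_iff] at this
          simp only [A, mem_inter_iff]
          tauto
        rw [this]
        exact (hC.inter_right isClosed_closure).inter_right hu
      · intro t ht hconst
        rcases t.eq_empty_or_nonempty with rfl | ⟨z, hz⟩
        · simp
        · obtain ⟨w, hw, hwz⟩ := (ht hz).2
          have hwt : w ∉ t := fun hwt =>
            Set.disjoint_left.1 B.2 (ht hwt).1.2 hw.2
          have := hN (insert w t) (by
            rw [Finset.coe_insert]
            exact insert_subset hw.1 (ht.trans (hAC B))) (by
            have hfz : ∀ v ∈ insert w t, f v = f z := by
              intro v hv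
              rcases Finset.mem_insert.1 hv with rfl | hv
              · exact hwz
              · exact hconst v hv z hz
            intro v hv v' hv'
            rw [hfz v hv, hfz v' hv'])
          rw [Finset.card_insert_of_notMem hwt] at this
          omega
    refine RelMC.of_disjoint_closed (RelMC.iUnion hA) (iUnion_subset hAC) fun R hR hRA => ?_
    refine RelMC.of_injOn (hC.inter_right hR) (hf.mono inter_subset_left) ?_
      (hW.mono_of_isClosed ((hC.inter_right hR).image_of_continuousOn
        (hf.mono inter_subset_left)).isClosed (subset_univ _))
    intro z hz w hw hzw
    by_contra hne
    obtain ⟨u, hzu, hu, v, hwv, hv, huv⟩ := exists_open_nhds_disjoint_closure hne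
    obtain ⟨b, hb, hzb, hbu⟩ := (isBasis_countableBasis Z).exists_subset_of_mem_open hzu hu
    obtain ⟨d, hd, hwd, hdv⟩ := (isBasis_countableBasis Z).exists_subset_of_mem_open hwv hv
    refine Set.disjoint_left.1 hRA hz.2 (mem_iUnion.2
      ⟨⟨(⟨b, hb⟩, ⟨d, hd⟩), huv.mono (closure_mono hbu) (closure_mono hdv)⟩, ?_⟩)
    exact ⟨⟨hz.1, subset_closure hzb⟩, w, ⟨hw.1, subset_closure hwd⟩, hzw.symm⟩

end RelMC

section WID

variable {Z : Type*} [TopologicalSpace Z]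

lemma IsWID.isMCSpace_two (h : IsWID Z) : IsMCSpace 2 Z := by
  intro G hG hcov
  obtain ⟨L, hL, hLe⟩ := h (fun i => (G i 1)ᶜ) (fun i => (G i 0)ᶜ)
    (fun i => (hG i 1).isClosed_compl) (fun i => (hG i 0).isClosed_compl) (fun i => by
      refine Set.disjoint_left.2 fun z h1 h0 => ?_
      have : z ∈ ⋃ j, G i j := (hcov i) ▸ mem_univ z
      obtain ⟨j, hj⟩ := mem_iUnion.1 this
      fin_cases j
      exacts [h0 hj, h1 hj])
  choose _ U V hU hV hUV hAU hBV hLUV using hL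
  refine ⟨fun i => {U i, V i}, ?_, ?_, ?_, ?_⟩
  · rintro i W (rfl | rfl)
    exacts [hU i, hV i]
  · rintro i W (rfl | rfl) W' (rfl | rfl) hne
    exacts [(hne rfl).elim, hUV i, (hUV i).symm, (hne rfl).elim]
  · rintro i W (rfl | rfl)
    · exact ⟨0, fun z hz => by_contra fun hz' => Set.disjoint_left.1 (hUV i) hz (hBV i hz')⟩
    · exact ⟨1, fun z hz => by_contra fun hz' => Set.disjoint_left.1 (hUV i) (hAU i hz') hz⟩
  · refine eq_univ_of_forall fun z => ?_
    have : z ∉ ⋂ i, L i := hLe ▸ notMem_empty z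
    obtain ⟨i, hi⟩ := by simpa only [mem_iInter, not_forall] using this
    have hz : z ∈ (L i)ᶜ := hi
    rw [hLUV] at hz
    rcases hz with hz | hz
    exacts [mem_iUnion.2 ⟨i, U i, Or.inl rfl, hz⟩, mem_iUnion.2 ⟨i, V i, Or.inr rfl, hz⟩]

lemma RelMC.isWID [NormalSpace Z] (h : RelMC 2 (univ : Set Z)) : IsWID Z := by
  intro A B hA hB hAB
  choose A' hA' hAA' hA'B using fun i => normal_exists_closure_subset (hA i)
    (hB i).isOpen_compl (Set.disjoint_left.1 (hAB i))
  choose B' hB' hBB' hB'A using fun i => normal_exists_closure_subset (hB i)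
    (isClosed_closure (s := A' i)).isOpen_compl fun z hz hz' => hA'B i hz' hz
  obtain ⟨H, hHo, hHr, hHd, hHc⟩ := h
    (fun i => ![(closure (B' i))ᶜ, (closure (A' i))ᶜ]) (fun i j => by
      fin_cases j
      exacts [isClosed_closure.isOpen_compl, isClosed_closure.isOpen_compl]) (fun i z _ => by
      by_cases hz : z ∈ closure (B' i)
      · exact mem_iUnion.2 ⟨1, hB'A i hz⟩
      · exact mem_iUnion.2 ⟨0, hz⟩)
  have h0 : ∀ i, H i 0 ⊆ (closure (B' i))ᶜ := fun i => hHr i 0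
  have h1 : ∀ i, H i 1 ⊆ (closure (A' i))ᶜ := fun i => hHr i 1
  have hU : ∀ i, IsOpen (H i 0 ∪ A' i) := fun i => (hHo i 0).union (hA' i)
  have hV : ∀ i, IsOpen (H i 1 ∪ B' i) := fun i => (hHo i 1).union (hB' i)
  refine ⟨fun i => ((H i 0 ∪ A' i) ∪ (H i 1 ∪ B' i))ᶜ, fun i =>
    ⟨((hU i).union (hV i)).isClosed_compl, _, _, hU i, hV i, ?_,
      (hAA' i).trans subset_union_right, (hBB' i).trans subset_union_right, compl_compl _⟩, ?_⟩
  · refine Set.disjoint_left.2 ?_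
    rintro z (hz | hz) (hz' | hz')
    · exact Set.disjoint_left.1 (hHd i (by decide : (0 : Fin 2) ≠ 1)) hz hz'
    · exact h0 i hz (subset_closure hz')
    · exact h1 i hz' (subset_closure hz)
    · exact hB'A i (subset_closure hz') (subset_closure hz)
  · refine eq_empty_of_forall_notMem fun z hz => ?_
    obtain ⟨i, hi⟩ := mem_iUnion.1 (hHc (mem_univ z))
    obtain ⟨j, hj⟩ := mem_iUnion.1 hi
    refine mem_iInter.1 hz i ?_
    fin_cases j
    exacts [Or.inl (Or.inl hj), Or.inr (Or.inl hj)]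

end WID

/-- A finite oscillation bound for `φ` at `y`, controlled by the values on `S`. -/
def Controls {X Y : Type*} {EX : Set (X → ℝ)} {EY : Set (Y → ℝ)} (φ : EX → EY)
    (q : ℕ) (y : Y) (S : Set X) : Prop :=
  ∀ f g : EX, (∀ x ∈ S, |(f : X → ℝ) x - (g : X → ℝ) x| < 1) →
    |(φ f : Y → ℝ) y - (φ g : Y → ℝ) y| ≤ q

/-- A set of continuous functions that contains `f + u * (g - f)` whenever it contains `f` and `g`
and `u` is continuous with values in `[0, 1]`. -/
structure IsMixing {X : Type*} [TopologicalSpace X] (E : Set (X → ℝ)) : Prop where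
  continuous : ∀ f ∈ E, Continuous f
  mix : ∀ f ∈ E, ∀ g ∈ E, ∀ u : X → ℝ, Continuous u → (∀ x, u x ∈ Icc (0 : ℝ) 1) →
    (fun x => f x + u x * (g x - f x)) ∈ E

section Controls

variable {X Y : Type*}
  {EX : Set (X → ℝ)} {EY : Set (Y → ℝ)} {φ : EX → EY}

lemma isMixing_CpSet [TopologicalSpace X] : IsMixing (CpSet X) where
  continuous _ hf := hf
  mix f hf g hg u hu _ := by
    have hf : Continuous f := hf
    have hg : Continuous g := hg
    show Continuous _
    fun_prop

lemma isMixing_CpStarSet [TopologicalSpace X] : IsMixing (CpStarSet X) where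
  continuous _ hf := hf.1
  mix f hf g hg u hu hu' := by
    obtain ⟨hf, M, hM⟩ := hf
    obtain ⟨hg, M', hM'⟩ := hg
    refine ⟨by fun_prop, M + M', fun x => ?_⟩
    obtain ⟨h0, h1⟩ := hu' x
    have e : f x + u x * (g x - f x) = (1 - u x) * f x + u x * g x := by ring
    show |f x + u x * (g x - f x)| ≤ M + M'
    rw [e]
    refine (abs_add_le _ _).trans (add_le_add ?_ ?_)
    · rw [abs_mul, abs_of_nonneg (by linarith)]
      exact (mul_le_of_le_one_left (abs_nonneg _) (by linarith)).trans (hM x)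
    · rw [abs_mul, abs_of_nonneg h0]
      exact (mul_le_of_le_one_left (abs_nonneg _) h1).trans (hM' x)

lemma IsMixing.exists_controls [TopologicalSpace X] (hE : IsMixing EX)
    (hφ : IsUnifContPt EX EY φ) (y : Y) :
    ∃ S : Finset X, ∃ q : ℕ, Controls φ q y S := by
  obtain ⟨V, hV, h⟩ := hφ {g | |g y| < 1} (by
    refine (isOpen_lt (by fun_prop) continuous_const).mem_nhds ?_
    simp)
  rw [nhds_pi, Filter.mem_pi] at hV
  obtain ⟨I, hI, t, ht, hVt⟩ := hV
  choose δ hδ hδt using fun x => Metric.mem_nhds_iff.1 (ht x)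
  obtain ⟨ε, hε, hεδ⟩ : ∃ ε > 0, ∀ x ∈ I, ε ≤ δ x := by
    rcases I.eq_empty_or_nonempty with rfl | hne
    · exact ⟨1, one_pos, by simp⟩
    · obtain ⟨x, -, hx⟩ := exists_min_image I δ hI hne
      exact ⟨δ x, hδ x, hx⟩
  obtain ⟨k, hk⟩ := exists_nat_one_div_lt hε
  refine ⟨hI.toFinset, k + 1, fun f g hfg => ?_⟩
  have hk0 : (0 : ℝ) < k + 1 := by positivity
  let F : ℕ → X → ℝ := fun i x => f.1 x + (min (i : ℝ) (k + 1) / (k + 1)) * (g.1 x - f.1 x)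
  have hF : ∀ i, F i ∈ EX := fun i => hE.mix _ f.2 _ g.2 _ continuous_const fun x =>
    ⟨div_nonneg (le_min (by positivity) hk0.le) hk0.le, (div_le_one hk0).2 (min_le_right _ _)⟩
  have step : ∀ i, i < k + 1 →
      |(φ ⟨F i, hF i⟩ : Y → ℝ) y - (φ ⟨F (i + 1), hF (i + 1)⟩ : Y → ℝ) y| < 1 := by
    intro i hi
    refine h ⟨F i, hF i⟩ ⟨F (i + 1), hF (i + 1)⟩ (hVt fun x hx => hδt x ?_)
    rw [Pi.zero_apply, mem_ball_zero_iff, Real.norm_eq_abs]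
    have hi' : (i : ℝ) + 1 ≤ k + 1 := by exact_mod_cast hi
    have e : F i x - F (i + 1) x = (1 / (k + 1)) * (f.1 x - g.1 x) := by
      simp only [F]
      push_cast
      rw [min_eq_left hi', min_eq_left (by linarith)]
      field_simp
      ring
    show |F i x - F (i + 1) x| < δ x
    rw [e, abs_mul, abs_of_pos (by positivity)]
    have := hfg x (by simpa using hx)
    calc 1 / ((k : ℝ) + 1) * |f.1 x - g.1 x| ≤ 1 / ((k : ℝ) + 1) * 1 := by gcongr
      _ < ε := by simpa using hk
      _ ≤ δ x := hεδ x hx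
  have main : ∀ i, i ≤ k + 1 →
      |(φ ⟨F 0, hF 0⟩ : Y → ℝ) y - (φ ⟨F i, hF i⟩ : Y → ℝ) y| ≤ i := by
    intro i
    induction i with
    | zero => simp
    | succ i ih =>
      intro hi
      push_cast
      exact (abs_sub_le _ ((φ ⟨F i, hF i⟩ : Y → ℝ) y) _).trans
        (add_le_add (ih (by omega)) (step i (by omega)).le)
  have h0 : (⟨F 0, hF 0⟩ : EX) = f := by
    apply Subtype.ext
    funext x
    simp [F, hk0.le]
  have h1 : (⟨F (k + 1), hF (k + 1)⟩ : EX) = g := by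
    apply Subtype.ext
    funext x
    simp [F, hk0.ne']
  have := main (k + 1) le_rfl
  rwa [h0, h1] at this

lemma Controls.mono {q : ℕ} {y : Y} {S T : Set X} (h : Controls φ q y S) (hST : S ⊆ T) :
    Controls φ q y T := fun f g hfg => h f g fun x hx => hfg x (hST hx)

lemma Controls.inter [TopologicalSpace X] [NormalSpace X] [T1Space X] (hE : IsMixing EX)
    {q : ℕ} {y : Y} {S T : Set X}
    (hS : S.Finite) (hT : T.Finite) (h : Controls φ q y S) (h' : Controls φ q y T) :
    Controls φ (2 * q) y (S ∩ T) := by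
  intro f g hfg
  obtain ⟨u, hu0, hu1, hu⟩ := exists_continuous_zero_one_of_isClosed hS.isClosed
    (hT.subset sdiff_subset : (T \ S).Finite).isClosed disjoint_sdiff_right
  let k : EX := ⟨_, hE.mix _ f.2 _ g.2 u u.continuous hu⟩
  have h1 := h f k (fun x hx => by simp [k, hu0 hx])
  have h2 := h' k g (fun x hx => by
    by_cases hxS : x ∈ S
    · simpa [k, hu0 hxS] using hfg x ⟨hxS, hx⟩
    · simp [k, hu1 ⟨hx, hxS⟩])
  push_cast
  linarith [abs_sub_le ((φ f : Y → ℝ) y) ((φ k : Y → ℝ) y) ((φ g : Y → ℝ) y)]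

lemma isClosed_controls [TopologicalSpace X] [TopologicalSpace Y] {p : ℕ}
    (hX : ∀ f ∈ EX, Continuous f) (hY : ∀ g ∈ EY, Continuous g)
    (q : ℕ) : IsClosed {z : Y × (Fin p → X) | Controls φ q z.1 (range z.2)} := by
  simp only [Controls, ofPred_forall, forall_mem_range]
  refine isClosed_iInter fun f => isClosed_iInter fun g => ?_
  have hf := hX f f.2
  have hg := hX g g.2
  have hf' := hY _ (φ f).2
  have hg' := hY _ (φ g).2
  refine isClosed_imp ?_ (isClosed_le (by fun_prop) continuous_const)
  simp only [ofPred_forall]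
  exact isOpen_iInter_of_finite fun i => isOpen_lt (by fun_prop) continuous_const

lemma IsCGood.card_le [TopologicalSpace Y] [NormalSpace Y] [T1Space Y] {c : ℝ}
    (hc : 0 < c) (hφ : IsCGood c φ) (hY : ∀ (M : ℝ) (g : Y → ℝ), Continuous g → (∀ y, |g y| ≤ M) → g ∈ EY)
    (p q : ℕ) : ∃ N : ℕ, ∀ (x : Fin p → X) (t : Finset Y),
      (∀ y ∈ t, Controls φ q y (range x)) → t.card ≤ N := by
  classical
  let M : ℝ := q + 1
  have hM : 0 ≤ M := by positivity
  let B : ℤ := ⌈c * M⌉ + 1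
  refine ⟨Fintype.card (Fin p → Finset.Icc (-B) B), fun x t ht => ?_⟩
  choose u hu0 hu1 hu using fun s : t.powerset => exists_continuous_zero_one_of_isClosed
    (t \ s.1).finite_toSet.isClosed s.1.finite_toSet.isClosed
    (Finset.disjoint_coe.2 Finset.sdiff_disjoint)
  have hbd : ∀ s y, |M * u s y| ≤ M := fun s y => by
    rw [abs_of_nonneg (mul_nonneg hM (hu s y).1)]
    exact mul_le_of_le_one_right hM (hu s y).2
  let g : t.powerset → EY := fun s =>
    ⟨fun y => M * u s y, hY M _ (by fun_prop) (hbd s)⟩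
  choose f hf hfb hfn using fun s => hφ (g s) ⟨M, hbd s⟩
  have hfle : ∀ s x, |(f s : X → ℝ) x| ≤ c * M := by
    intro s x
    obtain ⟨K, hK⟩ := hfb s
    calc |(f s : X → ℝ) x| ≤ supNorm (f s : X → ℝ) :=
          le_ciSup (f := fun x => |(f s : X → ℝ) x|)
            ⟨K, by rintro _ ⟨x, rfl⟩; exact hK x⟩ x
      _ ≤ c * supNorm (g s : Y → ℝ) := hfn s
      _ ≤ c * M := by
        gcongr
        exact Real.iSup_le (hbd s) hM
  let code : t.powerset → Fin p → Finset.Icc (-B) B := fun s i =>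
    ⟨⌊(f s : X → ℝ) (x i)⌋, by
      have h := abs_le.1 (hfle s (x i))
      have hce := Int.le_ceil (c * M)
      rw [Finset.mem_Icc]
      constructor
      · rw [Int.le_floor]
        simp only [B]
        push_cast
        linarith
      · rw [← Int.lt_add_one_iff, Int.floor_lt]
        simp only [B]
        push_cast
        linarith⟩
  have hinj : Function.Injective code := by
    intro s s' hss
    have hclose : ∀ z ∈ range x, |(f s : X → ℝ) z - (f s' : X → ℝ) z| < 1 := by
      rintro _ ⟨i, rfl⟩
      exact Int.abs_sub_lt_one_of_floor_eq_floor
        (congrArg Subtype.val (congrFun hss i))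
    have hval : ∀ y ∈ t, |M * u s y - M * u s' y| ≤ q := by
      intro y hy
      have := ht y hy _ _ hclose
      rwa [hf, hf] at this
    have hu' : ∀ s : t.powerset, ∀ y ∈ t, u s y = if y ∈ s.1 then 1 else 0 := by
      intro s y hy
      split_ifs with hys
      · exact hu1 s hys
      · exact hu0 s (by simp [hy, hys])
    apply Subtype.ext
    ext y
    by_cases hy : y ∈ t
    · have := hval y hy
      rw [hu' s y hy, hu' s' y hy] at this
      by_contra hne
      have habs : |M| ≤ q := by
        by_cases h1 : y ∈ s.1 <;> by_cases h2 : y ∈ s'.1 <;> simp_all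
      rw [abs_of_nonneg hM] at habs
      simp only [M] at habs
      linarith
    · exact ⟨fun h => (hy (Finset.mem_powerset.1 s.2 h)).elim,
        fun h => (hy (Finset.mem_powerset.1 s'.2 h)).elim⟩
  have := Fintype.card_le_of_injective code hinj
  rw [Fintype.card_coe, Finset.card_powerset] at this
  exact Nat.lt_two_pow_self.le.trans this

end Controls

/-- A compact set with a continuous map into a finite power of `X` whose fibres are of bounded
finite size. -/
def IsPiece (X : Type*) {Y : Type*} [TopologicalSpace X] [TopologicalSpace Y] (D : Set Y) : Prop :=
  IsCompact D ∧ ∃ (p : ℕ) (f : Y → Fin p → X), ContinuousOn f D ∧ ∃ N, FibersLE f D N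

/-- A compact set which is the graph of a function is the graph of a continuous function. -/
lemma IsCompact.exists_continuousOn_of_injOn_fst {Y W : Type*} [TopologicalSpace Y]
    [TopologicalSpace W] [T2Space Y] {S : Set (Y × W)} (hS : IsCompact S)
    (hinj : InjOn Prod.fst S) (hne : S.Nonempty) :
    ∃ f : Y → W, ContinuousOn f (Prod.fst '' S) ∧ ∀ y ∈ Prod.fst '' S, (y, f y) ∈ S := by
  have : Nonempty W := ⟨hne.some.2⟩
  have h : ∀ y, ∃ w, y ∈ Prod.fst '' S → (y, w) ∈ S := by
    intro y
    by_cases hy : y ∈ Prod.fst '' S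
    · obtain ⟨⟨y, w⟩, hz, rfl⟩ := hy
      exact ⟨w, fun _ => hz⟩
    · exact ⟨this.some, fun h => (hy h).elim⟩
  choose f hf using h
  refine ⟨f, continuousOn_iff_isClosed.2 fun T hT => ?_, hf⟩
  refine ⟨Prod.fst '' (S ∩ Prod.snd ⁻¹' T),
    ((hS.inter_right (hT.preimage continuous_snd)).image continuous_fst).isClosed, ?_⟩
  ext y
  constructor
  · rintro ⟨hT, hy⟩
    exact ⟨⟨(y, f y), ⟨hf y hy, hT⟩, rfl⟩, hy⟩
  · rintro ⟨⟨⟨y, w⟩, ⟨hz, hw⟩, rfl⟩, hy⟩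
    have : ((y, w) : Y × W) = (y, f y) := hinj hz (hf y hy) rfl
    have e : w = f y := congrArg Prod.snd this
    exact ⟨show f y ∈ T from e ▸ hw, hy⟩

section Decomposition

variable {X Y : Type*} [TopologicalSpace X] [TopologicalSpace Y]
  {EX : Set (X → ℝ)} {EY : Set (Y → ℝ)} {φ : EX → EY}

/-- Points with a minimal controlling set inside a compact box of pairwise separated closed sets. -/
lemma isPiece_image_fst [MetrizableSpace X] [MetrizableSpace Y] (hE : IsMixing EX)
    {p q N : ℕ} (hN : ∀ (x : Fin p → X) (t : Finset Y),
      (∀ y ∈ t, Controls φ q y (range x)) → t.card ≤ N)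
    {B : Fin p → Set X} (hB : Pairwise fun i j => Disjoint (B i) (B j))
    {S : Set (Y × (Fin p → X))} (hS : IsCompact S)
    (hSφ : ∀ z ∈ S, Controls φ q z.1 (range z.2)) (hSB : ∀ z ∈ S, ∀ i, z.2 i ∈ B i)
    (hmin : ∀ z ∈ S, ∀ p' < p, ∀ x' : Fin p' → X, range x' ⊆ range z.2 →
      ¬ Controls φ (2 * q) z.1 (range x')) :
    IsPiece X (Prod.fst '' S) := by
  classical
  refine ⟨hS.image continuous_fst, ?_⟩
  rcases S.eq_empty_or_nonempty with rfl | hne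
  · refine ⟨0, fun _ => Fin.elim0, by simp, 0, fun t ht _ => ?_⟩
    rw [image_empty] at ht
    simp [Finset.coe_eq_empty.1 (subset_empty_iff.1 ht)]
  have hinj : InjOn Prod.fst S := by
    rintro ⟨y, x⟩ hx ⟨y', x'⟩ hx' (rfl : y = y')
    have hsub : range x ⊆ range x' := by
      by_contra hnot
      have hc := (hSφ _ hx).inter hE (finite_range x) (finite_range x') (hSφ _ hx')
      let T : Finset X := (Finset.univ.image x).filter (· ∈ range x')
      have hT : (T : Set X) = range x ∩ range x' := by
        ext z
        simp [T]
      have hcard : T.card < p := by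
        have h1 : T ⊂ Finset.univ.image x := by
          refine Finset.filter_ssubset.2 ?_
          obtain ⟨_, ⟨i, rfl⟩, hi⟩ := not_subset.1 hnot
          exact ⟨x i, by simp, hi⟩
        exact (Finset.card_lt_card h1).trans_le (Finset.card_image_le.trans (by simp))
      have hr : range (fun i => (T.equivFin.symm i : X)) = range x ∩ range x' := by
        rw [← hT]
        ext z
        simp only [mem_range, Finset.mem_coe]
        exact ⟨by rintro ⟨i, rfl⟩; exact (T.equivFin.symm i).2,
          fun hz => ⟨T.equivFin ⟨z, hz⟩, by simp⟩⟩
      exact hmin _ hx _ hcard _ (hr.le.trans inter_subset_left) (hr ▸ hc)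
    have : x = x' := by
      funext i
      obtain ⟨k, hk⟩ := hsub ⟨i, rfl⟩
      by_cases hki : k = i
      · rw [← hk, hki]
      · exact (Set.disjoint_left.1 (hB hki) (hSB _ hx' k) (hk.symm ▸ hSB _ hx i : x' k ∈ B i)).elim
    rw [this]
  obtain ⟨f, hf, hfS⟩ := hS.exists_continuousOn_of_injOn_fst hinj hne
  refine ⟨p, f, hf, N, fun t ht hconst => ?_⟩
  rcases t.eq_empty_or_nonempty with rfl | ⟨y, hy⟩
  · simp
  · exact hN (f y) t fun w hw => hconst w hw y hy ▸ hSφ _ (hfS w (ht hw))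

lemma exists_pairwise_disjoint_closure [MetrizableSpace X] [SecondCountableTopology X] {p : ℕ}
    {x : Fin p → X} (hx : Function.Injective x) :
    ∃ B : Fin p → countableBasis X,
      (Pairwise fun i j => Disjoint (closure (B i : Set X)) (closure (B j : Set X))) ∧
      ∀ i, x i ∈ closure (B i : Set X) := by
  obtain ⟨U, hU, hd⟩ := (finite_range x).t2_separation
  choose b hb hxb hbU using fun i => (isBasis_countableBasis X).exists_closure_subset
    ((hU (x i)).2.mem_nhds (hU (x i)).1)
  exact ⟨fun i => ⟨b i, hb i⟩, fun i j hij =>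
    (hd ⟨i, rfl⟩ ⟨j, rfl⟩ (hx.ne hij)).mono (hbU i) (hbU j), fun i => subset_closure (hxb i)⟩

lemma exists_countable_isPiece [MetrizableSpace X] [MetrizableSpace Y] [SigmaCompactSpace X]
    [SigmaCompactSpace Y] (hE : IsMixing EX) (hY : ∀ g ∈ EY, Continuous g)
    (hφ : IsUnifContPt EX EY φ)
    (hcard : ∀ p q : ℕ, ∃ N : ℕ, ∀ (x : Fin p → X) (t : Finset Y),
      (∀ y ∈ t, Controls φ q y (range x)) → t.card ≤ N) :
    ∃ 𝒟 : Set (Set Y), 𝒟.Countable ∧ (∀ D ∈ 𝒟, IsPiece X D) ∧ ⋃₀ 𝒟 = univ := by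
  let _ := metrizableSpaceMetric Y
  let KX := compactCovering X
  let KY := compactCovering Y
  have hKX : ∀ n, IsCompact (KX n) := isCompact_compactCovering X
  have hKY : ∀ n, IsCompact (KY n) := isCompact_compactCovering Y
  let M : ℕ → ℕ → ℕ → Set Y := fun p q L => ⋃ p' : Fin p, Prod.fst ''
    ({z : Y × (Fin p' → X) | Controls φ (2 * q) z.1 (range z.2)} ∩
      KY L ×ˢ univ.pi fun _ => KX L)
  have hM : ∀ p q L, IsClosed (M p q L) := fun p q L => by
    refine isClosed_iUnion_of_finite fun p' => IsCompact.isClosed ?_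
    exact (((hKY L).prod (isCompact_univ_pi fun _ => hKX L)).inter_left
      (isClosed_controls hE.continuous hY _)).image continuous_fst
  choose F hF _ hFM _ using fun p q L => (hM p q L).isOpen_compl.exists_iUnion_isClosed
  have hFM' : ∀ p q L s, F p q L s ⊆ (M p q L)ᶜ := fun p q L s =>
    (subset_iUnion (F p q L) s).trans (hFM p q L).le
  let ι := Σ p : ℕ, ℕ × ℕ × ℕ × {B : Fin p → countableBasis X //
    Pairwise fun i j => Disjoint (closure (B i : Set X)) (closure (B j : Set X))}
  let S : ∀ a : ι, Set (Y × (Fin a.1 → X)) := fun ⟨p, q, L, s, B⟩ =>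
    ({z | Controls φ q z.1 (range z.2)} ∩
      KY L ×ˢ univ.pi fun i => KX L ∩ closure (B.1 i : Set X)) ∩ Prod.fst ⁻¹' F p q L s
  refine ⟨range fun a : ι => Prod.fst '' S a, countable_range _, ?_, ?_⟩
  · rintro _ ⟨⟨p, q, L, s, B, hB⟩, rfl⟩
    obtain ⟨N, hN⟩ := hcard p q
    refine isPiece_image_fst hE hN hB ?_ (fun z hz => hz.1.1)
      (fun z hz i => (hz.1.2.2 i (mem_univ i)).2) ?_
    · exact (((hKY L).prod (isCompact_univ_pi fun i =>
        (hKX L).inter_right isClosed_closure)).inter_left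
        (isClosed_controls hE.continuous hY _)).inter_right ((hF p q L s).preimage continuous_fst)
    · intro z hz p' hp' x' hx' hc
      refine hFM' p q L s hz.2 (mem_iUnion.2 ⟨⟨p', hp'⟩, (z.1, x'), ⟨hc, hz.1.2.1, ?_⟩, rfl⟩)
      intro i _
      obtain ⟨k, hk⟩ := hx' ⟨i, rfl⟩
      show x' i ∈ KX L
      rw [← hk]
      exact (hz.1.2.2 k (mem_univ k)).1
  · refine eq_univ_of_forall fun y => ?_
    have hex : ∃ p, ∃ (x : Fin p → X) (q : ℕ), Controls φ q y (range x) := by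
      obtain ⟨T, q, h⟩ := hE.exists_controls hφ y
      refine ⟨T.card, fun i => T.equivFin.symm i, q, h.mono fun z hz => ?_⟩
      exact ⟨T.equivFin ⟨z, hz⟩, by simp⟩
    classical
    let p := Nat.find hex
    obtain ⟨x, q, hx⟩ : ∃ (x : Fin p → X) (q : ℕ), Controls φ q y (range x) := Nat.find_spec hex
    have hminp : ∀ p' < p, ∀ (x' : Fin p' → X) (q' : ℕ), ¬ Controls φ q' y (range x') :=
      fun p' hp' x' q' h => Nat.find_min hex hp' ⟨x', q', h⟩
    have hxinj : Function.Injective x := by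
      by_contra hni
      let T : Finset X := Finset.univ.image x
      have hT : T.card < p := by
        refine lt_of_le_of_ne (Finset.card_image_le.trans (by simp)) fun h => hni ?_
        exact injOn_univ.1 (by simpa using Finset.card_image_iff.1 (h.trans (by simp)))
      refine hminp _ hT (fun i => T.equivFin.symm i) q (hx.mono ?_)
      rintro _ ⟨i, rfl⟩
      exact ⟨T.equivFin ⟨x i, by simp [T]⟩, by simp⟩
    obtain ⟨B, hB, hxB⟩ := exists_pairwise_disjoint_closure hxinj
    obtain ⟨l, hl⟩ := exists_mem_compactCovering y
    choose n hn using fun i => exists_mem_compactCovering (x i)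
    let L := max l (Finset.univ.sup n)
    have hyL : y ∈ KY L := compactCovering_subset Y (le_max_left _ _) hl
    have hxL : ∀ i, x i ∈ KX L := fun i => compactCovering_subset X
      ((Finset.le_sup (Finset.mem_univ i)).trans (le_max_right _ _)) (hn i)
    have hyM : y ∈ (M p q L)ᶜ := by
      intro h
      obtain ⟨p', z, hz, hzy⟩ := mem_iUnion.1 h
      have hz1 : Controls φ (2 * q) z.1 (range z.2) := hz.1
      exact hminp _ p'.2 z.2 _ (hzy ▸ hz1)
    rw [← hFM] at hyM
    obtain ⟨s, hs⟩ := mem_iUnion.1 hyM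
    exact ⟨_, ⟨⟨p, q, L, s, B, hB⟩, rfl⟩, (y, x),
      ⟨⟨hx, hyL, fun i _ => ⟨hxL i, hxB i⟩⟩, hs⟩, rfl⟩

lemma relMC_univ_pi [MetrizableSpace X] [MetrizableSpace Y] [SigmaCompactSpace Y] {m : ℕ}
    [NeZero m] (hX : ∀ n : ℕ, IsMCSpace m (Fin n → X)) {n : ℕ} {D : Fin n → Set Y}
    (hD : ∀ i, IsPiece X (D i)) : RelMC m (univ.pi D) := by
  classical
  choose hDc p f hf N hN using hD
  let F : (Fin n → Y) → Fin (∑ i, p i) → X := fun y s =>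
    f (finSigmaFinEquiv.symm s).1 (y (finSigmaFinEquiv.symm s).1) (finSigmaFinEquiv.symm s).2
  have hF : ∀ y i (j : Fin (p i)), F y (finSigmaFinEquiv ⟨i, j⟩) = f i (y i) j := by
    intro y i j
    simp only [F]
    rw [Equiv.symm_apply_apply]
  refine (hX (∑ i, p i)).relMC_univ.of_fibersLE (f := F) (∏ i, N i)
    (isCompact_univ_pi hDc) ?_ ?_
  · refine continuousOn_pi.2 fun s => ?_
    have h1 := (hf (finSigmaFinEquiv.symm s).1).comp
      (continuous_apply (finSigmaFinEquiv.symm s).1).continuousOn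
      (fun (y : Fin n → Y) (hy : y ∈ univ.pi D) => hy _ (mem_univ _))
    exact (continuous_apply _).comp_continuousOn h1
  · intro t ht hconst
    have hsub : t ⊆ Fintype.piFinset fun i => t.image (· i) := fun y hy =>
      Fintype.mem_piFinset.2 fun i => Finset.mem_image_of_mem _ hy
    refine (Finset.card_le_card hsub).trans ?_
    rw [Fintype.card_piFinset]
    refine Finset.prod_le_prod' fun i _ => hN i _ ?_ ?_
    · intro z hz
      obtain ⟨y, hy, rfl⟩ := Finset.mem_image.1 hz
      exact ht hy i (mem_univ i)
    · intro z hz w hw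
      obtain ⟨y, hy, rfl⟩ := Finset.mem_image.1 hz
      obtain ⟨y', hy', rfl⟩ := Finset.mem_image.1 hw
      funext j
      rw [← hF, ← hF, hconst y hy y' hy']

lemma relMC_univ_of_countable_isPiece [MetrizableSpace X] [MetrizableSpace Y]
    [SigmaCompactSpace Y] {m : ℕ} [NeZero m] (hX : ∀ n : ℕ, IsMCSpace m (Fin n → X))
    {𝒟 : Set (Set Y)} (h𝒟 : 𝒟.Countable) (hD : ∀ D ∈ 𝒟, IsPiece X D) (hcov : ⋃₀ 𝒟 = univ)
    (n : ℕ) : RelMC m (univ : Set (Fin n → Y)) := by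
  have : Countable 𝒟 := h𝒟.to_subtype
  have h : (⋃ k : Fin n → 𝒟, univ.pi fun i => (k i : Set Y)) = univ := by
    refine eq_univ_of_forall fun y => ?_
    have hy : ∀ i, ∃ D ∈ 𝒟, y i ∈ D := fun i => mem_sUnion.1 (hcov ▸ mem_univ (y i))
    choose k hk hyk using hy
    exact mem_iUnion.2 ⟨fun i => ⟨k i, hk i⟩, fun i _ => hyk i⟩
  rw [← h]
  exact RelMC.iUnion fun k => relMC_univ_pi hX fun i => hD _ (k i).2

end Decomposition

theorem statement2 {X Y : Type*} [TopologicalSpace X] [TopologicalSpace Y]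
    [MetrizableSpace X] [MetrizableSpace Y]
    [SigmaCompactSpace X] [SigmaCompactSpace Y]
    (EX : Set (X → ℝ)) (EY : Set (Y → ℝ))
    (hD : (EX = CpSet X ∧ EY = CpSet Y) ∨ (EX = CpStarSet X ∧ EY = CpStarSet Y))
    (φ : EX → EY) (hsurj : Function.Surjective φ)
    (hunif : IsUnifContPt EX EY φ)
    (c : ℝ) (hc : 0 < c) (hgood : IsCGood c φ) :
    ((∀ n : ℕ, IsWID (Fin n → X)) → ∀ n : ℕ, IsWID (Fin n → Y)) ∧
    (∀ m : ℕ, 2 ≤ m →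
      (∀ n : ℕ, IsMCSpace m (Fin n → X)) → ∀ n : ℕ, IsMCSpace m (Fin n → Y)) := by
  have hE : IsMixing EX := by
    rcases hD with ⟨rfl, -⟩ | ⟨rfl, -⟩
    exacts [isMixing_CpSet, isMixing_CpStarSet]
  have hY : ∀ g ∈ EY, Continuous g := by
    rcases hD with ⟨-, rfl⟩ | ⟨-, rfl⟩
    exacts [fun g hg => hg, fun g hg => hg.1]
  have hYb : ∀ (M : ℝ) (g : Y → ℝ), Continuous g → (∀ y, |g y| ≤ M) → g ∈ EY := by
    rcases hD with ⟨-, rfl⟩ | ⟨-, rfl⟩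
    exacts [fun M g hg _ => hg, fun M g hg hM => ⟨hg, M, hM⟩]
  obtain ⟨𝒟, h𝒟, hpiece, hcov⟩ := exists_countable_isPiece hE hY hunif (hgood.card_le hc hYb)
  refine ⟨fun h n => RelMC.isWID ?_, fun m hm h n => RelMC.isMCSpace ?_⟩
  · exact relMC_univ_of_countable_isPiece (fun k => (h k).isMCSpace_two) h𝒟 hpiece hcov n
  · have : NeZero m := ⟨by omega⟩
    exact relMC_univ_of_countable_isPiece h h𝒟 hpiece hcov n
end

section
/- Let X be a separable metrizable space with dim X = 0 and let E(X) be a countable subfamily of C*(X). Then there exists a metrizable compactification X̄ of X with dim X̄ = 0 such that every f ∈ E(X) extends to a continuous real-valued function on X̄. -/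
open Set Topology TopologicalSpace

universe u

def IsCozero {X : Type*} [TopologicalSpace X] (U : Set X) : Prop :=
  ∃ f : X → ℝ, Continuous f ∧ U = {x | f x ≠ 0}

/-- Covering dimension at most `0`, defined via finite functionally open (cozero) covers. -/
def CovDimLE0 (X : Type*) [TopologicalSpace X] : Prop :=
  ∀ (n : ℕ) (U : Fin n → Set X), (∀ i, IsCozero (U i)) → (⋃ i, U i) = Set.univ →
    ∃ (m : ℕ) (V : Fin m → Set X), (∀ j, IsCozero (V j)) ∧ (⋃ j, V j) = Set.univ ∧
      (∀ j, ∃ i, V j ⊆ U i) ∧ Pairwise (Function.onFun Disjoint V)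

/-- `dim X = 0`. -/
def CovDimEq0 (X : Type*) [TopologicalSpace X] : Prop :=
  Nonempty X ∧ CovDimLE0 X

/-- A metrizable compactification of `X`: a compact metrizable (Hausdorff) space together
with a dense topological embedding of `X`. -/
structure MetrizableCompactification (X : Type u) [TopologicalSpace X] where
  space : Type u
  top : TopologicalSpace space
  compact : @CompactSpace space top
  t2 : @T2Space space top
  metrizable : @MetrizableSpace space top
  emb : X → space
  isEmbedding : @Topology.IsEmbedding X space _ top emb
  denseRange : @DenseRange space top X emb

open Filter

theorem isCozero_setOf_pos {X : Type*} [TopologicalSpace X] {f : X → ℝ} (hf : Continuous f) :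
    IsCozero {x | 0 < f x} :=
  ⟨fun x => max (f x) 0, by fun_prop, by
    ext x
    simp only [mem_ofPred_eq, ne_eq, max_eq_right_iff, not_le]⟩

theorem IsCozero.isOpen {X : Type*} [TopologicalSpace X] {U : Set X} (hU : IsCozero U) :
    IsOpen U := by
  obtain ⟨f, hf, rfl⟩ := hU
  exact isOpen_ne_fun hf continuous_const

theorem IsClopen.isCozero {X : Type*} [TopologicalSpace X] {U : Set X} (hU : IsClopen U) :
    IsCozero U :=
  ⟨U.indicator 1, continuous_one.indicator (by simp [hU.frontier_eq]), by ext x; simp⟩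

theorem covDimLE0_of_profinite (K : Type*) [TopologicalSpace K] [CompactSpace K] [T2Space K]
    [TotallyDisconnectedSpace K] : CovDimLE0 K := by
  intro n U hU hcover
  have hopen : IsOpenCover fun i => (⟨U i, (hU i).isOpen⟩ : Opens K) :=
    IsOpenCover.mk (by ext x; simp [← hcover])
  obtain ⟨m, V, hVU, hV, hd⟩ := hopen.exists_finite_nonempty_disjoint_clopen_cover
  refine ⟨m, fun j => V j, fun j => (V j).isClopen.isCozero, univ_subset_iff.mp hV,
    fun j => (hVU j).2, fun i j hij => ?_⟩
  have h := hd hij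
  simp only [Function.onFun, disjoint_iff] at h ⊢
  exact congrArg (SetLike.coe : Clopens K → Set K) h

/-- In a space of covering dimension at most `0`, a clopen set separates the sets `f ≤ a` and
`b ≤ f` whenever `a < b`. -/
theorem CovDimLE0.exists_isClopen_between {X : Type*} [TopologicalSpace X] (hX : CovDimLE0 X)
    {f : X → ℝ} (hf : Continuous f) {a b : ℝ} (hab : a < b) :
    ∃ C : Set X, IsClopen C ∧ (∀ x ∈ C, f x < b) ∧ ∀ x ∉ C, a < f x := by
  obtain ⟨m, V, hV, hcover, hVU, hd⟩ := hX 2 ![{x | 0 < b - f x}, {x | 0 < f x - a}]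
    (by
      intro i
      fin_cases i
      · exact isCozero_setOf_pos (by fun_prop)
      · exact isCozero_setOf_pos (by fun_prop))
    (by
      refine eq_univ_of_forall fun x => mem_iUnion.mpr ?_
      rcases lt_or_ge (f x) b with h | h
      · exact ⟨0, by simpa using h⟩
      · exact ⟨1, by simpa using hab.trans_le h⟩)
  have hmem (x : X) : ∃ j, x ∈ V j := mem_iUnion.mp (hcover ▸ mem_univ x)
  set J : Set (Fin m) := {j | ∀ x ∈ V j, f x < b}
  have hcompl : (⋃ j ∈ J, V j)ᶜ = ⋃ j ∈ Jᶜ, V j := by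
    ext x
    simp only [mem_compl_iff, mem_iUnion, exists_prop, not_exists, not_and]
    constructor
    · intro h
      obtain ⟨j, hj⟩ := hmem x
      exact ⟨j, fun hJ => h j hJ hj, hj⟩
    · rintro ⟨j, hj, hx⟩ k hk hxk
      have hjk : j ≠ k := fun h => hj (h ▸ hk)
      exact disjoint_left.mp (hd hjk) hx hxk
  refine ⟨⋃ j ∈ J, V j, ⟨⟨?_⟩, isOpen_biUnion fun j _ => (hV j).isOpen⟩, ?_, ?_⟩
  · rw [hcompl]
    exact isOpen_biUnion fun j _ => (hV j).isOpen
  · intro x hx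
    obtain ⟨j, hj, hxj⟩ := mem_iUnion₂.mp hx
    exact hj x hxj
  · intro x hx
    have hx' : x ∈ ⋃ j ∈ Jᶜ, V j := hcompl ▸ hx
    obtain ⟨j, hj, hxj⟩ := mem_iUnion₂.mp hx'
    obtain ⟨i, hi⟩ := hVU j
    fin_cases i
    · exact absurd (fun y hy => by simpa using hi hy) hj
    · simpa using hi hxj

theorem statement6 {X : Type u} [TopologicalSpace X] [MetrizableSpace X] [SeparableSpace X]
    (hX : CovDimEq0 X)
    (E : Set (X → ℝ)) (hEcount : E.Countable)
    (hEcont : ∀ f ∈ E, Continuous f ∧ ∃ M, ∀ x, |f x| ≤ M) :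
    ∃ K : MetrizableCompactification X,
      @CovDimEq0 K.space K.top ∧
      ∀ f ∈ E, ∃ F : K.space → ℝ, @Continuous K.space ℝ K.top _ F ∧
        ∀ x, F (K.emb x) = f x := by
  obtain ⟨hne, hdim⟩ := hX
  let _ : MetricSpace X := metrizableSpaceMetric X
  set S : Set (X → ℝ) := E ∪ range fun n x => dist x (denseSeq X n)
  have hScont : ∀ f ∈ S, Continuous f := by
    rintro f (hf | ⟨n, rfl⟩)
    · exact (hEcont f hf).1
    · fun_prop
  have : Countable S := (hEcount.union (countable_range _)).to_subtype
  have hsep (i : S × ℚ × ℚ) : ∃ C : Set X, IsClopen C ∧ ((i.2.1 : ℝ) < i.2.2 →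
      (∀ x ∈ C, i.1.1 x < i.2.2) ∧ ∀ x ∉ C, i.2.1 < i.1.1 x) := by
    by_cases h : (i.2.1 : ℝ) < i.2.2
    · obtain ⟨C, hC, hC'⟩ := hdim.exists_isClopen_between (hScont i.1 i.1.2) h
      exact ⟨C, hC, fun _ => hC'⟩
    · exact ⟨∅, isClopen_empty, fun h' => absurd h' h⟩
  choose C hC hCsep using hsep
  let φ : X → (S × ℚ × ℚ → Bool) := fun x i => (C i).boolIndicator x
  have hφ : Continuous φ :=
    continuous_pi fun i => (continuous_boolIndicator_iff_isClopen _).mpr (hC i)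
  let K : Set (S × ℚ × ℚ → Bool) := closure (range φ)
  let e : X → K := fun x => ⟨φ x, subset_closure (mem_range_self x)⟩
  have he : Continuous e := hφ.subtype_mk _
  have hcoord (i : S × ℚ × ℚ) : Continuous fun y : K => y.1 i :=
    (continuous_apply i).comp continuous_subtype_val
  have hdense : DenseRange e := by
    intro y
    rw [closure_subtype, ← range_comp]
    exact y.2
  have hi : IsDenseInducing e := by
    refine IsDenseInducing.mk' e he hdense fun x s hs => ?_
    obtain ⟨ε, hε, hball⟩ := Metric.mem_nhds_iff.mp hs
    obtain ⟨n, hn⟩ := (denseRange_denseSeq X).exists_dist_lt x (half_pos hε)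
    obtain ⟨r, hnr, hr⟩ := exists_rat_btwn hn
    obtain ⟨q, hnq, hqr⟩ := exists_rat_btwn hnr
    let i : S × ℚ × ℚ := (⟨_, Or.inr (mem_range_self n)⟩, q, r)
    have hx : x ∈ C i := by
      by_contra hx
      exact lt_asymm hnq ((hCsep i hqr).2 x hx)
    refine ⟨{y | y.1 i = true}, ((hcoord i).isOpen_preimage _ (isOpen_discrete {true})).mem_nhds
      ((mem_iff_boolIndicator _ _).mp hx), fun z hz => hball ?_⟩
    have hzr : dist z (denseSeq X n) < r :=
      (hCsep i hqr).1 z ((mem_iff_boolIndicator _ _).mpr hz)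
    have := dist_triangle_right z x (denseSeq X n)
    rw [Metric.mem_ball]
    linarith
  have hK : IsCompact K := isClosed_closure.isCompact
  have : CompactSpace K := isCompact_iff_compactSpace.mp hK
  refine ⟨⟨K, inferInstance, inferInstance, inferInstance, inferInstance, e,
    ⟨hi.isInducing, hi.isInducing.injective⟩, hdense⟩, ⟨hne.map e, covDimLE0_of_profinite K⟩, ?_⟩
  intro f hf
  obtain ⟨hfc, M, hM⟩ := hEcont f hf
  refine ⟨hi.extend f, hi.continuous_extend fun y => ?_, hi.extend_eq hfc⟩
  refine tendsto_of_no_upcrossings (Rat.denseRange_cast (𝕜 := ℝ)) ?_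
    (isBoundedUnder_of ⟨M, fun x => (abs_le.mp (hM x)).2⟩)
    (isBoundedUnder_of ⟨-M, fun x => (abs_le.mp (hM x)).1⟩)
  rintro _ ⟨q, rfl⟩ _ ⟨r, rfl⟩ hqr ⟨h1, h2⟩
  let i : S × ℚ × ℚ := (⟨f, Or.inl hf⟩, q, r)
  have hev : ∀ᶠ x in comap e (𝓝 y), (e x).1 i = y.1 i :=
    tendsto_comap.eventually (((hcoord i).tendsto y).eventually (IsOpen.mem_nhds
      (isOpen_discrete {y.1 i}) rfl))
  cases hy : y.1 i
  · refine h1 (hev.mono fun x hx => ?_)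
    have hxC : x ∉ C i := (notMem_iff_boolIndicator _ _).mpr (hx.trans hy)
    exact ((hCsep i hqr).2 x hxC).not_gt
  · refine h2 (hev.mono fun x hx => ?_)
    have hxC : x ∈ C i := (mem_iff_boolIndicator _ _).mpr (hx.trans hy)
    exact ((hCsep i hqr).1 x hxC).not_gt
end

section
/- Let X and Y be separable metrizable spaces, E(X) ⊆ C(X) a countable QS-algebra on X, and E(Y) ⊆ C(Y) a countable family. Suppose there are metrizable compactifications X̄ and Ȳ of X and Y and a countable base ℬ of X̄ such that: (i) every f ∈ E(X) extends to a continuous map f̄: X̄ → [−∞, ∞], and for every finite open cover γ = {U_1, …, U_k} of X̄ with elements of ℬ there exists a partition of unity {f̄_1, …, f̄_k} subordinated to γ with each f_i ∈ E(X); (ii) every g ∈ E(Y) extends to a continuous map ḡ: Ȳ → [−∞, ∞], and the set of all real-valued elements of E_p(Ȳ) = { ḡ : g ∈ E(Y) } is dense in C_p(Ȳ); (iii) for every compact set K ⊆ X̄ and every open set W ⊆ X̄ containing K there is f ∈ E(X) with f̄(K) = 1, f̄(X̄∖W) = 0 and f(x) ∈ [0,1] for all x ∈ X. If X̄ has a property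 𝒫 satisfying conditions (a′), (b), (c′) and (d′), and φ: E_p(X) → E_p(Y) is a linear continuous surjection that can be continuously extended over the linear hull LE_p(X), then Y has the property 𝒫. -/
open Set Topology TopologicalSpace

universe u

/-- A QS-algebra on `X`. -/
def IsQSAlgebra {X : Type*} [TopologicalSpace X] (E : Set (X → ℝ)) : Prop :=
  (∀ f ∈ E, Continuous f) ∧
  (∀ f ∈ E, ∀ g ∈ E, f + g ∈ E ∧ f * g ∈ E) ∧
  (∀ f ∈ E, ∀ q : ℚ, (q : ℝ) • f ∈ E) ∧
  (∀ x : X, ∀ U ∈ nhds x, ∃ f ∈ E, f x = 1 ∧ ∀ y ∉ U, f y = 0)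

/-- A functional on `E` with extended real values which is additive and `ℚ`-homogeneous wherever
its values are finite. -/
structure IsRatLinearOn {X : Type*} (E : Set (X → ℝ)) (L : (X → ℝ) → EReal) : Prop where
  add : ∀ f ∈ E, ∀ g ∈ E, ∀ a b : ℝ, L f = a → L g = b → L (f + g) = ((a + b : ℝ) : EReal)
  smul : ∀ f ∈ E, ∀ q : ℚ, ∀ a : ℝ, L f = a → L ((q : ℝ) • f) = ((q * a : ℝ) : EReal)
  zero : L 0 = 0

/-- The support in `Z` of a functional on `E`, where `e : X → Z`. -/
def functionalSupport {X Z : Type*} [TopologicalSpace Z] (e : X → Z) (E : Set (X → ℝ))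
    (L : (X → ℝ) → EReal) : Set Z :=
  {z | ∀ U ∈ 𝓝 z, ∃ f ∈ E, (∀ x, e x ∉ U → f x = 0) ∧ L f ≠ 0}

/-- Finite covers by members of `B` admit partitions of unity by members of `E`. -/
def HasPartitions {X Z : Type*} (e : X → Z) (E : Set (X → ℝ)) (B : Set (Set Z)) : Prop :=
  ∀ (k : ℕ) (U : Fin k → Set Z), (∀ i, U i ∈ B) → (⋃ i, U i) = univ →
    ∃ F : Fin k → X → ℝ, (∀ i, F i ∈ E) ∧ (∀ x, ∑ i, F i x = 1) ∧
      ∀ i x, e x ∉ U i → F i x = 0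

/-- Members of `E` separate compact sets from complements of open neighbourhoods. -/
def HasUrysohn {X Z : Type*} [TopologicalSpace Z] (e : X → Z) (E : Set (X → ℝ)) : Prop :=
  ∀ K : Set Z, IsCompact K → ∀ W : Set Z, IsOpen W → K ⊆ W →
    ∃ f ∈ E, (∀ x, e x ∈ K → f x = 1) ∧ (∀ x, e x ∉ W → f x = 0) ∧ ∀ x, f x ∈ Icc (0 : ℝ) 1

section functional

variable {X Z : Type*} [TopologicalSpace X] [TopologicalSpace Z] {e : X → Z} {E : Set (X → ℝ)}
  {L : (X → ℝ) → EReal} {B : Set (Set Z)}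

theorem IsRatLinearOn.sum_smul (hE : IsQSAlgebra E) (hL : IsRatLinearOn E L) {ι : Type*}
    (s : Finset ι) (f : ι → X → ℝ) (hf : ∀ i, f i ∈ E) (h0 : (0 : X → ℝ) ∈ E) (a : ι → ℝ)
    (ha : ∀ i, L (f i) = a i) (q : ι → ℚ) :
    ∑ i ∈ s, (q i : ℝ) • f i ∈ E ∧
      L (∑ i ∈ s, (q i : ℝ) • f i) = ((∑ i ∈ s, (q i : ℝ) * a i : ℝ) : EReal) := by
  classical
  induction s using Finset.induction_on with
  | empty => simpa using ⟨h0, hL.zero⟩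
  | insert i s hi ih =>
    rw [Finset.sum_insert hi, Finset.sum_insert hi]
    exact ⟨(hE.2.1 _ (hE.2.2.1 _ (hf i) _) _ ih.1).1,
      hL.add _ (hE.2.2.1 _ (hf i) _) _ ih.1 _ _ (hL.smul _ (hf i) _ _ (ha i)) ih.2⟩

theorem IsQSAlgebra.zero_mem (hE : IsQSAlgebra E) {f : X → ℝ} (hf : f ∈ E) :
    (0 : X → ℝ) ∈ E := by
  simpa using hE.2.2.1 f hf 0

theorem eq_zero_of_vanishes_near_support [CompactSpace Z] (hE : IsQSAlgebra E)
    (hL : IsRatLinearOn E L) (hB : IsTopologicalBasis B) (hPU : HasPartitions e E B)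
    {W : Set Z} (hW : IsOpen W) (hsW : functionalSupport e E L ⊆ W) {f : X → ℝ} (hf : f ∈ E)
    (hfW : ∀ x, e x ∈ W → f x = 0) : L f = 0 := by
  have key : ∀ z : Z, ∃ U ∈ B, z ∈ U ∧
      ∀ g ∈ E, (∀ x, e x ∉ U → g x = 0) → (∀ x, e x ∈ W → g x = 0) → L g = 0 := by
    intro z
    by_cases hz : z ∈ functionalSupport e E L
    · obtain ⟨U, hUB, hzU, hUW⟩ := hB.exists_subset_of_mem_open (hsW hz) hW
      refine ⟨U, hUB, hzU, fun g _ h1 h2 => ?_⟩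
      have : g = 0 := by
        funext x
        by_cases hx : e x ∈ U
        · exact h2 x (hUW hx)
        · exact h1 x hx
      rw [this, hL.zero]
    · simp only [functionalSupport, mem_ofPred_eq, not_forall, not_exists, not_and, not_not] at hz
      obtain ⟨V, hV, h⟩ := hz
      obtain ⟨U, hUB, hzU, hUV⟩ := hB.mem_nhds_iff.1 hV
      exact ⟨U, hUB, hzU, fun g hg h1 _ => h g hg fun x hx => h1 x fun hx' => hx (hUV hx')⟩
  choose U hUB hzU hU using key
  obtain ⟨t, ht⟩ := CompactSpace.elim_nhds_subcover U
    fun z => (hB.isOpen (hUB z)).mem_nhds (hzU z)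
  obtain ⟨F, hFE, hFsum, hFU⟩ := hPU t.card (fun i => U (t.equivFin.symm i)) (fun i => hUB _) (by
    refine eq_univ_of_forall fun z => ?_
    obtain ⟨w, hw, hzw⟩ := mem_iUnion₂.1 (ht.symm ▸ mem_univ z : z ∈ ⋃ x ∈ t, U x)
    exact mem_iUnion.2 ⟨t.equivFin ⟨w, hw⟩, by simpa using hzw⟩)
  have hmem : ∀ i, f * F i ∈ E := fun i => (hE.2.1 _ hf _ (hFE i)).2
  have hzero : ∀ i, L (f * F i) = ((0 : ℝ) : EReal) := fun i => by
    rw [EReal.coe_zero]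
    refine hU (t.equivFin.symm i) _ (hmem i) (fun x hx => ?_) fun x hx => ?_
    · simp [hFU i x hx]
    · simp [hfW x hx]
  have hsum := (hL.sum_smul hE Finset.univ _ hmem (hE.zero_mem hf) _ hzero fun _ => 1).2
  have hfe : f = ∑ i, ((1 : ℚ) : ℝ) • (f * F i) := by
    funext x
    simp [Finset.sum_apply, ← Finset.mul_sum, hFsum]
  rw [← hfe] at hsum
  simpa using hsum

/-- A functional bounded by `p` on the unit ball of `E` is bounded on functions that are only
bounded on the support. -/
theorem exists_real_value_of_bounded [CompactSpace Z] [T2Space Z] (he : IsInducing e)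
    (hE : IsQSAlgebra E) (hL : IsRatLinearOn E L) (hB : IsTopologicalBasis B)
    (hPU : HasPartitions e E B) (hUry : HasUrysohn e E) {p : ℝ}
    (hp : ∀ f ∈ E, (∀ x, |f x| ≤ 1) → L f ∈ Icc ((-p : ℝ) : EReal) (p : EReal))
    {A : Finset X} (hA : functionalSupport e E L = e '' A) {f : X → ℝ} (hf : f ∈ E) {r : ℚ}
    (hr : 0 < r) (hfr : ∀ x ∈ A, |f x| < r) :
    ∃ t : ℝ, L f = t ∧ |t| ≤ p * r := by
  obtain ⟨W, hW, hWf⟩ := he.isOpen_iff.1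
    (isOpen_lt (hE.1 f hf).abs continuous_const : IsOpen {x | |f x| < (r : ℝ)})
  have hSW : e '' (A : Set X) ⊆ W := by
    rintro _ ⟨x, hx, rfl⟩
    have : x ∈ e ⁻¹' W := by rw [hWf]; exact hfr x hx
    exact this
  have hS : IsCompact (e '' (A : Set X)) := (A.finite_toSet.image e).isCompact
  obtain ⟨V, hV, hSV, hVW⟩ := normal_exists_closure_subset hS.isClosed hW hSW
  obtain ⟨u, huE, hu1, hu0, hu⟩ := hUry _ isClosed_closure.isCompact W hW hVW
  have hfu : f * u ∈ E := (hE.2.1 _ hf _ huE).2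
  have hfuE : ((r⁻¹ : ℚ) : ℝ) • (f * u) ∈ E := hE.2.2.1 _ hfu _
  have hr' : (0 : ℝ) < r := by exact_mod_cast hr
  have hbd := hp _ hfuE fun x => by
    by_cases hx : e x ∈ W
    · have h1 : |f x| < r := by
        have : x ∈ e ⁻¹' W := hx
        rw [hWf] at this
        exact this
      have h2 : |f x * u x| ≤ r := by
        rw [abs_mul, abs_of_nonneg (hu x).1]
        nlinarith [abs_nonneg (f x), (hu x).1, (hu x).2]
      simp only [Pi.smul_apply, Pi.mul_apply, smul_eq_mul, Rat.cast_inv]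
      rw [abs_mul, abs_of_pos (inv_pos.2 hr'), inv_mul_le_iff₀ hr']
      simpa using h2
    · simp [hu0 x hx]
  obtain ⟨t, ht⟩ : ∃ t : ℝ, L (((r⁻¹ : ℚ) : ℝ) • (f * u)) = t := by
    refine ⟨_, (EReal.coe_toReal ?_ ?_).symm⟩
    · exact (hbd.2.trans_lt (EReal.coe_lt_top p)).ne
    · exact ((EReal.bot_lt_coe (-p)).trans_le hbd.1).ne'
  rw [ht] at hbd
  have htp : |t| ≤ p := abs_le.2 ⟨EReal.coe_le_coe_iff.1 hbd.1, EReal.coe_le_coe_iff.1 hbd.2⟩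
  have hnegE : ((-1 : ℚ) : ℝ) • (f * u) ∈ E := hE.2.2.1 _ hfu _
  have hdiff : L (f + ((-1 : ℚ) : ℝ) • (f * u)) = ((0 : ℝ) : EReal) := by
    refine eq_zero_of_vanishes_near_support hE hL hB hPU hV (hA ▸ hSV)
      (hE.2.1 _ hf _ hnegE).1 fun x hx => ?_
    simp [hu1 x (subset_closure hx)]
  have hLfu : L ((r : ℝ) • ((r⁻¹ : ℚ) : ℝ) • (f * u)) = ((r * t : ℝ) : EReal) :=
    hL.smul _ hfuE r t ht
  have e1 : (r : ℝ) • ((r⁻¹ : ℚ) : ℝ) • (f * u) = f * u := by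
    rw [smul_smul, Rat.cast_inv, mul_inv_cancel₀ hr'.ne', one_smul]
  rw [e1] at hLfu
  have := hL.add _ (hE.2.1 _ hf _ hnegE).1 _ hfu _ _ hdiff hLfu
  have e2 : f + ((-1 : ℚ) : ℝ) • (f * u) + f * u = f := by
    funext x; simp
  rw [e2, zero_add] at this
  refine ⟨_, this, ?_⟩
  rw [abs_mul, abs_of_pos hr', mul_comm]
  gcongr

theorem abs_le_mul_sum_of_bounded [CompactSpace Z] [T2Space Z] (he : IsInducing e)
    (hE : IsQSAlgebra E) (hL : IsRatLinearOn E L) (hB : IsTopologicalBasis B)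
    (hPU : HasPartitions e E B) (hUry : HasUrysohn e E) {p : ℝ}
    (hp : ∀ f ∈ E, (∀ x, |f x| ≤ 1) → L f ∈ Icc ((-p : ℝ) : EReal) (p : EReal))
    {A : Finset X} (hA : functionalSupport e E L = e '' A) {f : X → ℝ} (hf : f ∈ E) {a : ℝ}
    (ha : L f = a) : |a| ≤ p * ∑ x ∈ A, |f x| := by
  have h : ∀ r : ℚ, ∑ x ∈ A, |f x| < r → |a| ≤ p * r := fun r hr => by
    have hr0 : (0 : ℝ) < r := (Finset.sum_nonneg fun x _ => abs_nonneg (f x)).trans_lt hr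
    obtain ⟨t, ht, htr⟩ := exists_real_value_of_bounded he hE hL hB hPU hUry hp hA hf
      (Rat.cast_pos.1 hr0)
      fun x hx => (Finset.single_le_sum (fun y _ => abs_nonneg (f y)) hx).trans_lt hr
    rwa [EReal.coe_injective (ha.symm.trans ht)]
  by_contra! hlt
  obtain ⟨u, hu, hsub⟩ := exists_Ico_subset_of_mem_nhds
    ((isOpen_lt (continuous_const.mul continuous_id) continuous_const).mem_nhds hlt :
      {t | p * t < |a|} ∈ 𝓝 (∑ x ∈ A, |f x|)) ⟨_, lt_add_one _⟩
  obtain ⟨r, hr, hru⟩ := exists_rat_btwn hu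
  have hpr : p * r < |a| := hsub ⟨hr.le, hru⟩
  exact absurd (h r hr) hpr.not_ge

end functional

section family

variable {X Z K : Type*} [TopologicalSpace X] [TopologicalSpace Z] [CompactSpace Z] [T2Space Z]
  [TopologicalSpace K] {e : X → Z} {E : Set (X → ℝ)} {B : Set (Set Z)}
  {T : K → (X → ℝ) → EReal}

theorem isOpen_functionalSupport_inter_nonempty (hE : IsQSAlgebra E)
    (hB : IsTopologicalBasis B) (hPU : HasPartitions e E B)
    (hT : ∀ z, IsRatLinearOn E (T z)) (hcont : ∀ f ∈ E, Continuous fun z => T z f)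
    {U : Set Z} (hU : IsOpen U) :
    IsOpen {z | (functionalSupport e E (T z) ∩ U).Nonempty} := by
  rw [isOpen_iff_mem_nhds]
  rintro z ⟨x, hx, hxU⟩
  obtain ⟨V, hV, hxV, hVU⟩ := normal_exists_closure_subset (isClosed_singleton (x := x)) hU
    (singleton_subset_iff.2 hxU)
  obtain ⟨f, hf, hfV, hfz⟩ := hx V (hV.mem_nhds (hxV rfl))
  filter_upwards [(hcont f hf).continuousAt.eventually_ne hfz] with w hw
  by_contra hne
  change ¬(functionalSupport e E (T w) ∩ U).Nonempty at hne
  rw [not_nonempty_iff_eq_empty, ← disjoint_iff_inter_eq_empty] at hne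
  refine hw (eq_zero_of_vanishes_near_support hE (hT w) hB hPU
    (isClosed_closure (s := V)).isOpen_compl ?_ hf fun x hx => ?_)
  · exact fun y hy hyV => hne.le_bot ⟨hy, hVU hyV⟩
  · exact hfV x fun h => hx (subset_closure h)

/-- Points of `K` giving bounded functionals with a common finite support are finitely many. -/
theorem finite_setOf_functionalSupport_eq [NormalSpace K] [T1Space K] (he : IsInducing e)
    (hE : IsQSAlgebra E) (hB : IsTopologicalBasis B)
    (hPU : HasPartitions e E B) (hUry : HasUrysohn e E)
    (hT : ∀ z, IsRatLinearOn E (T z))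
    (hdense : {h : K → ℝ | Continuous h} ⊆
      closure {h : K → ℝ | ∃ f ∈ E, ∀ z, (h z : EReal) = T z f})
    (p : ℝ) (A : Finset X) :
    {z : K | (∀ f ∈ E, (∀ x, |f x| ≤ 1) → T z f ∈ Icc ((-p : ℝ) : EReal) (p : EReal)) ∧
      functionalSupport e E (T z) = e '' A}.Finite := by
  classical
  by_contra hinf
  obtain ⟨t, htD, htc⟩ := Set.Infinite.exists_subset_card_eq hinf (A.card + 1)
  set ε : ℝ := 1 / (2 * (t.card + 1)) with hε
  have hε0 : 0 < ε := by positivity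
  have hsep : ∀ i : t, ∃ f ∈ E, ∃ m : t → ℝ, (∀ j : t, T j f = m j) ∧
      ∀ j : t, |m j - if i = j then 1 else 0| < ε := by
    intro i
    obtain ⟨h, h0, h1, -⟩ := exists_continuous_zero_one_of_isClosed
      (s := ((t.erase i : Finset K) : Set K)) (t := {(i : K)})
      (t.erase (i : K)).finite_toSet.isClosed isClosed_singleton (by simp)
    have hO : IsOpen {k : K → ℝ | ∀ j : t, |k j - h j| < ε} := by
      simp only [ofPred_forall]
      exact isOpen_iInter_of_finite fun j =>
        isOpen_lt ((continuous_apply (j : K)).sub continuous_const).abs continuous_const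
    obtain ⟨k, hk, f, hf, hkf⟩ := mem_closure_iff.1 (hdense h.continuous) _ hO
      (by intro j; simpa using hε0)
    refine ⟨f, hf, fun j => k j, fun j => (hkf j).symm, fun j => ?_⟩
    have hkj := hk j
    by_cases hij : i = j
    · subst hij
      rw [h1 rfl] at hkj
      simpa using hkj
    · have : (j : K) ∈ ((t.erase i : Finset K) : Set K) := by
        simp only [Finset.coe_erase, mem_sdiff, Finset.mem_coe, j.2, true_and, mem_singleton_iff]
        exact fun h => hij (Subtype.ext h.symm)
      rw [h0 this] at hkj
      simpa [hij] using hkj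
  choose f hf M hM hMδ using hsep
  have hdet : (Matrix.of M).det ≠ 0 := by
    refine det_ne_zero_of_sum_row_lt_diag fun i => ?_
    have h1 : ∑ j ∈ Finset.univ.erase i, ‖M i j‖ ≤ ∑ j ∈ Finset.univ.erase i, ε := by
      refine Finset.sum_le_sum fun j hj => ?_
      have := hMδ i j
      rw [if_neg (Finset.ne_of_mem_erase hj).symm, sub_zero] at this
      exact this.le
    have h2 : 1 - ε < ‖M i i‖ := by
      have := (abs_lt.1 (by simpa using hMδ i i)).1
      exact lt_of_lt_of_le (by linarith) (le_abs_self _)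
    refine h1.trans_lt (lt_of_le_of_lt ?_ h2)
    rw [Finset.sum_const, nsmul_eq_mul]
    have hc : ((Finset.univ.erase i).card : ℝ) ≤ t.card := by
      exact_mod_cast (Finset.card_le_univ _).trans (by simp)
    have : (t.card + 1 : ℝ) * ε = 1 / 2 := by rw [hε]; field_simp
    nlinarith
  have hbound : ∀ (j : t) (c : t → ℝ),
      |∑ i, c i * M i j| ≤ p * ∑ x ∈ A, |∑ i, c i * f i x| := by
    intro j c
    have hd : DenseRange (Pi.map fun (_ : t) (q : ℚ) => (q : ℝ)) :=
      DenseRange.piMap fun _ => Rat.denseRange_cast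
    refine hd.induction_on (p := fun c : t → ℝ =>
      |∑ i, c i * M i j| ≤ p * ∑ x ∈ A, |∑ i, c i * f i x|) c
      (isClosed_le (by fun_prop) (by fun_prop)) fun q => ?_
    obtain ⟨hmem, hval⟩ := (hT j).sum_smul hE Finset.univ f hf (hE.zero_mem (hf j)) (fun i => M i j)
      (fun i => hM i j) q
    have := abs_le_mul_sum_of_bounded he hE (hT j) hB hPU hUry (htD j.2).1 (htD j.2).2 hmem hval
    simpa [Finset.sum_apply] using this
  obtain ⟨c, hc, hc0⟩ : ∃ c : t → ℝ, (∀ x : A, ∑ i, c i * f i x = 0) ∧ c ≠ 0 := by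
    have hker := LinearMap.ker_ne_bot_of_finrank_lt
      (f := Matrix.vecMulLinear (Matrix.of fun (i : t) (x : A) => f i x)) (by simp [htc])
    obtain ⟨c, hc, hc0⟩ := (Submodule.ne_bot_iff _).1 hker
    exact ⟨c, fun x => congrFun (LinearMap.mem_ker.1 hc) x, hc0⟩
  refine hc0 (Matrix.eq_zero_of_vecMul_eq_zero hdet ?_)
  funext j
  have h := hbound j c
  have h0 : ∑ x ∈ A, |∑ i, c i * f i x| = 0 :=
    Finset.sum_eq_zero fun x hx => by rw [hc ⟨x, hx⟩, abs_zero]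
  rw [h0, mul_zero] at h
  exact abs_nonpos_iff.1 h

end family

section setValued

variable {Z K : Type*} [TopologicalSpace Z] [TopologicalSpace K] {S : K → Set Z}

theorem isClosed_encard_le [T2Space Z]
    (hS : ∀ U : Set Z, IsOpen U → IsOpen {z | (S z ∩ U).Nonempty}) (n : ℕ) :
    IsClosed {z | (S z).encard ≤ n} := by
  rw [← isOpen_compl_iff, isOpen_iff_mem_nhds]
  intro z hz
  have hz' : ((n + 1 : ℕ) : ℕ∞) ≤ (S z).encard := by
    rw [mem_compl_iff, mem_ofPred_eq, not_le] at hz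
    exact_mod_cast Order.add_one_le_of_lt hz
  obtain ⟨t, htS, ht⟩ := exists_subset_encard_eq hz'
  have htf : t.Finite := finite_of_encard_eq_coe ht
  obtain ⟨U, hU, hdisj⟩ := htf.t2_separation
  have hev : ∀ᶠ w in 𝓝 z, ∀ x ∈ t, (S w ∩ U x).Nonempty :=
    (htf.eventually_all).2 fun x hx =>
      (hS _ (hU x).2).mem_nhds ⟨x, htS hx, (hU x).1⟩
  filter_upwards [hev] with w hw
  rw [mem_compl_iff, mem_ofPred_eq, not_le]
  choose! c hc using hw
  have hinj : InjOn c t := fun x hx y hy hxy =>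
    hdisj.elim hx hy (not_disjoint_iff.2 ⟨c x, (hc x hx).2, hxy ▸ (hc y hy).2⟩)
  calc ((n : ℕ) : ℕ∞) < ((n + 1 : ℕ) : ℕ∞) := by exact_mod_cast n.lt_succ_self
    _ = t.encard := ht.symm
    _ ≤ _ := encard_le_encard_of_injOn (fun x hx => (hc x hx).1) hinj

theorem exists_continuous_selection (hS : ∀ U : Set Z, IsOpen U → IsOpen {z | (S z ∩ U).Nonempty})
    {n : ℕ} {U : Fin n → Set Z} (hU : ∀ i, IsOpen (U i))
    (hdisj : Pairwise (Function.onFun Disjoint U)) {C : Set K}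
    (hCn : ∀ z ∈ C, (S z).encard ≤ n) (hCU : ∀ z ∈ C, ∀ i, (S z ∩ U i).Nonempty) :
    ∃ σ : C → Fin n → Z, Continuous σ ∧ ∀ z : C, S z = range (σ z) := by
  choose σ hσ using fun z : C => hCU z z.2
  have hinj : ∀ z, Function.Injective (σ z) := fun z i j hij => by
    by_contra hne
    exact disjoint_left.1 (hdisj hne) (hσ z i).2 (hij ▸ (hσ z j).2)
  have hrange : ∀ z : C, S z = range (σ z) := fun z => by
    refine ((finite_range (σ z)).eq_of_subset_of_encard_le ?_ ?_).symm
    · rintro _ ⟨i, rfl⟩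
      exact (hσ z i).1
    · refine (hCn z z.2).trans ?_
      rw [← image_univ, (hinj z).injOn.encard_image]
      simp
  refine ⟨σ, continuous_pi fun i => continuous_iff_continuousAt.2 fun z => ?_, hrange⟩
  refine (nhds_basis_opens _).tendsto_right_iff.2 fun V hV => ?_
  have hopen := (hS (V ∩ U i) (hV.2.inter (hU i))).preimage (continuous_subtype_val (p := (· ∈ C)))
  filter_upwards [hopen.mem_nhds ⟨σ z i, (hσ z i).1, hV.1, (hσ z i).2⟩] with w hw
  obtain ⟨x, hxS, hxV, hxU⟩ := hw
  rw [hrange w] at hxS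
  obtain ⟨j, rfl⟩ := hxS
  by_cases hij : i = j
  · rwa [hij]
  · exact (disjoint_left.1 (hdisj hij) hxU (hσ w j).2).elim

end setValued

/-- Hereditary properties of separable metrizable spaces that are preserved by countable closed
unions, by finite products, and inversely by perfect maps with zero-dimensional fibers. -/
structure IsDimensionLike (P : ∀ (Z : Type u) [TopologicalSpace Z], Prop) : Prop where
  subset : ∀ (Z : Type u) [TopologicalSpace Z] [MetrizableSpace Z] [SeparableSpace Z],
    P Z → ∀ S : Set Z, P ↥S
  iUnion : ∀ (Z : Type u) [TopologicalSpace Z] [MetrizableSpace Z] [SeparableSpace Z],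
    ∀ F : ℕ → Set Z, (∀ n, IsClosed (F n)) → (∀ n, P ↥(F n)) → (⋃ n, F n) = Set.univ → P Z
  perfect : ∀ (Z W : Type u) [TopologicalSpace Z] [TopologicalSpace W]
    [MetrizableSpace Z] [SeparableSpace Z] [MetrizableSpace W] [SeparableSpace W],
    ∀ f : Z → W, Continuous f → IsClosedMap f → (∀ w, IsCompact (f ⁻¹' {w})) →
      (∀ w, CovDimLE0 ↥(f ⁻¹' {w})) → P W → P Z
  prod : ∀ (Z W : Type u) [TopologicalSpace Z] [TopologicalSpace W]
    [MetrizableSpace Z] [SeparableSpace Z] [MetrizableSpace W] [SeparableSpace W],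
    P Z → P W → P (Z × W)

theorem covDimLE0_of_finite (X : Type*) [TopologicalSpace X] [T1Space X] [Finite X] :
    CovDimLE0 X := by
  intro n U _ hU
  obtain ⟨m, ⟨e⟩⟩ := Finite.exists_equiv_fin X
  refine ⟨m, fun j => {e.symm j}, fun j => ?_, ?_, fun j => ?_, fun i j hij => ?_⟩
  · classical
    refine ⟨fun x => if x = e.symm j then 1 else 0, continuous_of_discreteTopology, ?_⟩
    ext x
    simp
  · exact eq_univ_of_forall fun x => mem_iUnion.2 ⟨e x, by simp⟩
  · simpa using (hU.symm ▸ mem_univ (e.symm j) : e.symm j ∈ ⋃ i, U i)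
  · simpa [Function.onFun] using hij

namespace IsDimensionLike

variable {P : ∀ (Z : Type u) [TopologicalSpace Z], Prop}

theorem of_finite_fibers (hP : IsDimensionLike P) {Z W : Type u} [TopologicalSpace Z]
    [TopologicalSpace W] [MetrizableSpace Z] [SeparableSpace Z] [MetrizableSpace W]
    [SeparableSpace W] {f : Z → W} (hf : Continuous f) (hcl : IsClosedMap f)
    (hfin : ∀ w, (f ⁻¹' {w}).Finite) (hW : P W) : P Z :=
  hP.perfect Z W f hf hcl (fun w => (hfin w).isCompact)
    (fun w => have := (hfin w).to_subtype; covDimLE0_of_finite ↥(f ⁻¹' {w})) hW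

theorem of_isEmbedding (hP : IsDimensionLike P) {Z W : Type u} [TopologicalSpace Z]
    [TopologicalSpace W] [MetrizableSpace Z] [SeparableSpace Z] [MetrizableSpace W]
    [SecondCountableTopology W] {f : Z → W} (hf : IsEmbedding f) (hW : P W) : P Z :=
  hP.of_finite_fibers (f := hf.toHomeomorph) hf.toHomeomorph.continuous
    hf.toHomeomorph.isClosedMap
    (fun _ => (subsingleton_singleton.preimage hf.toHomeomorph.injective).finite)
    (hP.subset W hW (range f))

theorem of_countable_closed_cover (hP : IsDimensionLike P) {Z : Type u} [TopologicalSpace Z]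
    [MetrizableSpace Z] [SeparableSpace Z] {ι : Type*} [Countable ι] [Nonempty ι] (F : ι → Set Z)
    (hF : ∀ i, IsClosed (F i)) (hPF : ∀ i, P ↥(F i)) (hcov : ⋃ i, F i = univ) : P Z := by
  obtain ⟨g, hg⟩ := exists_surjective_nat ι
  refine hP.iUnion Z (F ∘ g) (fun n => hF _) (fun n => hPF _) ?_
  rw [← hcov]
  exact hg.iUnion_comp F

theorem pi_fin (hP : IsDimensionLike P) {Z : Type u} [TopologicalSpace Z] [CompactSpace Z]
    [MetrizableSpace Z] [SecondCountableTopology Z] [Nonempty Z] (hZ : P Z) :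
    ∀ n : ℕ, P (Fin n → Z)
  | 0 => hP.of_finite_fibers (f := fun _ => Classical.arbitrary Z) continuous_const
      (Continuous.isClosedMap continuous_const) (fun _ => toFinite _) hZ
  | n + 1 => by
    have hc : Continuous fun w : Fin (n + 1) → Z => (w 0, fun i : Fin n => w i.succ) := by
      fun_prop
    refine hP.of_finite_fibers hc hc.isClosedMap (fun _ => ?_) (hP.prod _ _ hZ (hP.pi_fin hZ n))
    refine (subsingleton_singleton.preimage fun v w h => ?_).finite
    rw [Prod.mk.injEq] at h
    exact funext (Fin.cases h.1 fun i => congrFun h.2 i)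

theorem of_finite_fibers_over (hP : IsDimensionLike P) {K M D : Type u} [TopologicalSpace K]
    [TopologicalSpace M] [TopologicalSpace D] [CompactSpace K] [MetrizableSpace K]
    [SecondCountableTopology K] [MetrizableSpace M] [SecondCountableTopology M]
    [MetrizableSpace D] [SeparableSpace D] {σ : K → M} (hσ : Continuous σ) {W : Set M} (hW : P W)
    (hfin : ∀ w ∈ W, (σ ⁻¹' {w}).Finite) {j : D → K} (hj : IsEmbedding j)
    (hjW : ∀ d, σ (j d) ∈ W) : P D := by
  have hpre : P ↥(σ ⁻¹' W) := by
    refine hP.of_finite_fibers (hσ.restrictPreimage (s := W)) (hσ.isClosedMap.restrictPreimage W)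
      (fun w => ?_) hW
    refine Finite.subset ((hfin w w.2).preimage Subtype.val_injective.injOn) fun z hz => ?_
    exact congrArg Subtype.val hz
  exact hP.of_isEmbedding (f := fun d => (⟨j d, hjW d⟩ : ↥(σ ⁻¹' W)))
    (IsEmbedding.of_comp (hj.continuous.subtype_mk _) continuous_subtype_val hj) hpre

end IsDimensionLike

theorem eq_add_of_eqOn_dense {K : Type*} [TopologicalSpace K] {s : Set K} (hs : Dense s)
    {F G H : K → EReal} (hF : Continuous F) (hG : Continuous G) (hH : Continuous H)
    (h : ∀ z ∈ s, H z = F z + G z) {z : K} {a b : ℝ} (ha : F z = a) (hb : G z = b) :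
    H z = ((a + b : ℝ) : EReal) := by
  have : (𝓝[s] z).NeBot := mem_closure_iff_nhdsWithin_neBot.1 (hs z)
  have hadd : Filter.Tendsto (fun w => F w + G w) (𝓝 z) (𝓝 (F z + G z)) :=
    (EReal.continuousAt_add (p := (F z, G z)) (by simp [ha]) (by simp [ha])).tendsto.comp
      (hF.continuousAt.prodMk hG.continuousAt)
  rw [EReal.coe_add, ← ha, ← hb]
  refine tendsto_nhds_unique (l := 𝓝[s] z) (hH.continuousAt.mono_left nhdsWithin_le_nhds)
    ((hadd.mono_left nhdsWithin_le_nhds).congr' ?_)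
  filter_upwards [self_mem_nhdsWithin] with w hw using (h w hw).symm

theorem eq_mul_of_eqOn_dense {K : Type*} [TopologicalSpace K] {s : Set K} (hs : Dense s)
    {F H : K → EReal} (hF : Continuous F) (hH : Continuous H) (c : ℝ)
    (h : ∀ z ∈ s, H z = c * F z) {z : K} {a : ℝ} (ha : F z = a) :
    H z = ((c * a : ℝ) : EReal) := by
  have : (𝓝[s] z).NeBot := mem_closure_iff_nhdsWithin_neBot.1 (hs z)
  have hmul : Filter.Tendsto (fun w => (c : EReal) * F w) (𝓝 z) (𝓝 (c * F z)) :=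
    EReal.Tendsto.const_mul hF.continuousAt (by simp) (by simp)
  rw [EReal.coe_mul, ← ha]
  refine tendsto_nhds_unique (l := 𝓝[s] z) (hH.continuousAt.mono_left nhdsWithin_le_nhds)
    ((hmul.mono_left nhdsWithin_le_nhds).congr' ?_)
  filter_upwards [self_mem_nhdsWithin] with w hw using (h w hw).symm

/-- A continuous functional for the pointwise topology is bounded in terms of finitely many
evaluations. -/
theorem exists_finset_bound {X : Type*} {V : Submodule ℝ (X → ℝ)} (l : V →ₗ[ℝ] ℝ)
    (hl : Continuous l) :
    ∃ (A : Finset X) (C : ℝ), ∀ f : V, (∀ x ∈ A, |(f : X → ℝ) x| ≤ 1) → |l f| ≤ C := by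
  obtain ⟨O, hO, hOl⟩ := isOpen_induced_iff.1
    (isOpen_lt hl.abs continuous_const : IsOpen {f : V | |l f| < 1})
  have h0 : (0 : X → ℝ) ∈ O := by
    have : (0 : V) ∈ Subtype.val ⁻¹' O := by rw [hOl]; simp
    exact this
  obtain ⟨A, u, hu, hAu⟩ := isOpen_pi_iff.1 hO 0 h0
  have hev : ∀ᶠ ε : ℝ in 𝓝[>] 0, ∀ x ∈ A, Metric.closedBall (0 : ℝ) ε ⊆ u x := by
    refine (Filter.eventually_all_finset A).2 fun x hx => ?_
    obtain ⟨δ, hδ, hball⟩ := Metric.isOpen_iff.1 (hu x hx).1 _ (hu x hx).2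
    filter_upwards [Ioo_mem_nhdsGT hδ] with ε hε
    exact (Metric.closedBall_subset_ball hε.2).trans hball
  obtain ⟨ε, hε, hε0⟩ := (hev.and self_mem_nhdsWithin).exists
  replace hε0 : 0 < ε := hε0
  refine ⟨A, ε⁻¹, fun f hf => ?_⟩
  have hmem : ε • f ∈ Subtype.val ⁻¹' O := by
    refine hAu fun x hx => hε x hx ?_
    simp only [Submodule.coe_smul, Pi.smul_apply, smul_eq_mul, mem_closedBall_zero_iff,
      Real.norm_eq_abs, abs_mul, abs_of_pos hε0]
    nlinarith [hf x hx]
  rw [hOl] at hmem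
  have : |ε * l f| < 1 := by simpa using hmem
  rw [abs_mul, abs_of_pos hε0] at this
  rw [← one_div, le_div_iff₀ hε0]
  linarith

theorem eq_zero_of_finset_bound {X : Type*} {V : Submodule ℝ (X → ℝ)} {l : V →ₗ[ℝ] ℝ}
    {A : Finset X} {C : ℝ} (h : ∀ f : V, (∀ x ∈ A, |(f : X → ℝ) x| ≤ 1) → |l f| ≤ C) {f : V}
    (hf : ∀ x ∈ A, (f : X → ℝ) x = 0) : l f = 0 := by
  by_contra hne
  have hpos : 0 < |l f| := abs_pos.2 hne
  have := h (((C + 1) / |l f|) • f) fun x hx => by simp [hf x hx]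
  have hC : 0 ≤ C := (abs_nonneg _).trans (h 0 (by simp))
  rw [map_smul, smul_eq_mul, abs_mul, abs_div, abs_abs, div_mul_cancel₀ _ hpos.ne',
    abs_of_nonneg (by linarith)] at this
  linarith

theorem statement8
    -- `X`, `Y` separable metrizable
    {X Y : Type u} [TopologicalSpace X] [TopologicalSpace Y]
    [MetrizableSpace X] [SeparableSpace X] [MetrizableSpace Y] [SeparableSpace Y]
    -- `E(X)` a countable QS-algebra on `X`, `E(Y)` a countable family in `C(Y)`
    (EX : Set (X → ℝ)) (hEXcount : EX.Countable) (hEXqs : IsQSAlgebra EX)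
    (EY : Set (Y → ℝ)) (hEYcount : EY.Countable) (hEYcont : ∀ g ∈ EY, Continuous g)
    -- metrizable compactifications `X̄` and `Ȳ`
    {Xbar Ybar : Type u} [TopologicalSpace Xbar] [TopologicalSpace Ybar]
    [CompactSpace Xbar] [T2Space Xbar] [MetrizableSpace Xbar]
    [CompactSpace Ybar] [T2Space Ybar] [MetrizableSpace Ybar]
    (eX : X → Xbar) (heX : Topology.IsEmbedding eX) (hdX : DenseRange eX)
    (eY : Y → Ybar) (heY : Topology.IsEmbedding eY) (hdY : DenseRange eY)
    -- a countable base `ℬ` of `X̄`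
    (B : Set (Set Xbar)) (hBbasis : IsTopologicalBasis B) (hBcount : B.Countable)
    -- (i) every `f ∈ E(X)` extends to a continuous map `f̄ : X̄ → [-∞,∞]` ...
    (hextX : ∀ f ∈ EX, ∃ F : Xbar → EReal, Continuous F ∧
      ∀ x, F (eX x) = (f x : EReal))
    -- ... and finite covers of `X̄` by members of `ℬ` admit subordinated partitions of unity
    -- consisting of extensions of members of `E(X)`
    (hPU : ∀ (k : ℕ) (U : Fin k → Set Xbar), (∀ i, U i ∈ B) → (⋃ i, U i) = Set.univ →
      ∃ F : Fin k → Xbar → ℝ,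
        (∀ i, Continuous (F i)) ∧
        (∀ i, ∃ f ∈ EX, ∀ x, F i (eX x) = f x) ∧
        (∀ i x, F i x ∈ Set.Icc (0 : ℝ) 1) ∧
        (∀ x, (∑ i, F i x) = 1) ∧
        (∀ i, ∀ x ∉ U i, F i x = 0))
    -- (ii) every `g ∈ E(Y)` extends to a continuous `ḡ : Ȳ → [-∞,∞]` and the set of
    -- real-valued elements of `E_p(Ȳ)` is dense in `C_p(Ȳ)`
    (extY : (Y → ℝ) → Ybar → EReal)
    (hextY : ∀ g ∈ EY, Continuous (extY g) ∧ ∀ y, extY g (eY y) = (g y : EReal))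
    (hdense : {h : Ybar → ℝ | Continuous h} ⊆
      closure {h : Ybar → ℝ | ∃ g ∈ EY, ∀ z, (h z : EReal) = extY g z})
    -- (iii) the Urysohn-type condition for compact `K ⊆ W ⊆ X̄`
    (h23 : ∀ K : Set Xbar, IsCompact K → ∀ W : Set Xbar, IsOpen W → K ⊆ W →
      ∃ f ∈ EX, ∃ F : Xbar → EReal, Continuous F ∧ (∀ x, F (eX x) = (f x : EReal)) ∧
        (∀ x ∈ K, F x = 1) ∧ (∀ x ∉ W, F x = 0) ∧ ∀ x, f x ∈ Set.Icc (0 : ℝ) 1)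
    -- `𝒫` is a property of separable metrizable spaces satisfying (a'), (b), (c'), (d')
    (P : ∀ (Z : Type u) [TopologicalSpace Z], Prop)
    (ha' : ∀ (Z : Type u) [TopologicalSpace Z] [MetrizableSpace Z] [SeparableSpace Z],
      P Z → ∀ S : Set Z, P ↥S)
    (hb : ∀ (Z : Type u) [TopologicalSpace Z] [MetrizableSpace Z] [SeparableSpace Z],
      ∀ F : ℕ → Set Z, (∀ n, IsClosed (F n)) → (∀ n, P ↥(F n)) →
        (⋃ n, F n) = Set.univ → P Z)
    (hc' : ∀ (Z W : Type u) [TopologicalSpace Z] [TopologicalSpace W]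
      [MetrizableSpace Z] [SeparableSpace Z] [MetrizableSpace W] [SeparableSpace W],
      ∀ f : Z → W, Continuous f → IsClosedMap f → (∀ w, IsCompact (f ⁻¹' {w})) →
        (∀ w, CovDimLE0 ↥(f ⁻¹' {w})) → P W → P Z)
    (hd' : ∀ (Z W : Type u) [TopologicalSpace Z] [TopologicalSpace W]
      [MetrizableSpace Z] [SeparableSpace Z] [MetrizableSpace W] [SeparableSpace W],
      P Z → P W → P (Z × W))
    -- `X̄` has the property `𝒫`
    (hXbarP : P Xbar)
    -- `φ : E_p(X) → E_p(Y)` is a linear continuous surjection continuously extendable over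
    -- the linear hull `LE_p(X)`: we record the (linear, continuous) extension `Φ`
    (Φ : ↥(Submodule.span ℝ EX) →ₗ[ℝ] (Y → ℝ))
    (hΦcont : Continuous Φ)
    (hΦmaps : ∀ f : ↥(Submodule.span ℝ EX), (f : X → ℝ) ∈ EX → Φ f ∈ EY)
    (hΦsurj : ∀ g ∈ EY, ∃ f : ↥(Submodule.span ℝ EX), (f : X → ℝ) ∈ EX ∧ Φ f = g) :
    P Y := by
  have hP : IsDimensionLike P := ⟨ha', hb, hc', hd'⟩
  have := hBbasis.secondCountableTopology hBcount
  have : SecondCountableTopology Ybar :=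
    letI := metrizableSpaceMetric Ybar
    UniformSpace.secondCountable_of_separable Ybar
  rcases isEmpty_or_nonempty Y with hY | hY
  · exact hP.of_finite_fibers (f := fun y : Y => (isEmptyElim y : Xbar)) (by fun_prop)
      (fun s _ => by simp [s.eq_empty_of_isEmpty]) (fun _ => toFinite _) hXbarP
  have hspan : ∀ f ∈ EX, f ∈ Submodule.span ℝ EX := fun f hf => Submodule.subset_span hf
  obtain ⟨T, hTeq⟩ : ∃ T : Ybar → (X → ℝ) → EReal,
      ∀ z f (hf : f ∈ Submodule.span ℝ EX), T z f = extY (Φ ⟨f, hf⟩) z := by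
    classical
    exact ⟨fun z f => if hf : f ∈ Submodule.span ℝ EX then extY (Φ ⟨f, hf⟩) z else 0,
      fun z f hf => dif_pos hf⟩
  have hTY : ∀ f (hf : f ∈ EX) y, T (eY y) f = (Φ ⟨f, hspan f hf⟩ y : EReal) := fun f hf y => by
    rw [hTeq _ f (hspan f hf)]
    exact (hextY _ (hΦmaps _ hf)).2 y
  have hTcont : ∀ f ∈ EX, Continuous fun z => T z f := fun f hf => by
    simp only [hTeq _ f (hspan f hf)]
    exact (hextY _ (hΦmaps _ hf)).1
  have hdense' : {h : Ybar → ℝ | Continuous h} ⊆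
      closure {h : Ybar → ℝ | ∃ f ∈ EX, ∀ z, (h z : EReal) = T z f} := by
    refine hdense.trans (closure_mono ?_)
    rintro h ⟨g, hg, hgh⟩
    obtain ⟨f, hf, rfl⟩ := hΦsurj g hg
    exact ⟨f, hf, fun z => by rw [hgh, hTeq z f f.2]⟩
  have hPU' : HasPartitions eX EX B := fun k U hUB hU => by
    obtain ⟨F, -, hF, -, hFsum, hFU⟩ := hPU k U hUB hU
    choose f hf hFf using hF
    exact ⟨f, hf, fun x => by simpa only [hFf] using hFsum (eX x),
      fun i x hx => by rw [← hFf, hFU i _ hx]⟩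
  have hUry : HasUrysohn eX EX := fun K hK W hW hKW => by
    obtain ⟨f, hf, F, -, hFf, hF1, hF0, hf01⟩ := h23 K hK W hW hKW
    exact ⟨f, hf, fun x hx => by exact_mod_cast (hFf x).symm.trans (hF1 _ hx),
      fun x hx => by exact_mod_cast (hFf x).symm.trans (hF0 _ hx), hf01⟩
  obtain ⟨f₀, hf₀⟩ : EX.Nonempty := by
    obtain ⟨h, f, hf, -⟩ := closure_nonempty_iff.1 ⟨_, hdense' (continuous_const (y := (0 : ℝ)))⟩
    exact ⟨f, hf⟩
  have h0 := hEXqs.zero_mem hf₀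
  have hT : ∀ z, IsRatLinearOn EX (T z) := fun z =>
    { add := fun f hf g hg a b ha hb => by
        have hfg := (hEXqs.2.1 f hf g hg).1
        refine eq_add_of_eqOn_dense hdY (hTcont f hf) (hTcont g hg) (hTcont _ hfg) ?_ ha hb
        rintro _ ⟨y, rfl⟩
        rw [hTY f hf, hTY g hg, hTY _ hfg, ← EReal.coe_add, ← Pi.add_apply, ← map_add]
        rfl
      smul := fun f hf q a ha => by
        have hqf := hEXqs.2.2.1 f hf q
        refine eq_mul_of_eqOn_dense hdY (hTcont f hf) (hTcont _ hqf) q ?_ ha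
        rintro _ ⟨y, rfl⟩
        rw [hTY f hf, hTY _ hqf, ← EReal.coe_mul, ← smul_eq_mul, ← Pi.smul_apply, ← map_smul]
        rfl
      zero := by
        refine congrFun (hdY.equalizer (hTcont 0 h0) (continuous_const (y := (0 : EReal)))
          (funext fun y => ?_)) z
        simp only [Function.comp_apply, hTY 0 h0, EReal.coe_eq_zero]
        exact congrFun (map_zero Φ) y }
  let S : Ybar → Set Xbar := fun z => functionalSupport eX EX (T z)
  have hSopen : ∀ U : Set Xbar, IsOpen U → IsOpen {z | (S z ∩ U).Nonempty} := fun U hU =>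
    isOpen_functionalSupport_inter_nonempty hEXqs hBbasis hPU' hT hTcont hU
  have hSne : ∀ z, (S z).Nonempty := fun z => by
    by_contra hne
    rw [not_nonempty_iff_eq_empty] at hne
    have hzero : ∀ f ∈ EX, T z f = 0 := fun f hf =>
      eq_zero_of_vanishes_near_support hEXqs (hT z) hBbasis hPU' isOpen_empty hne.subset hf
        fun x hx => hx.elim
    obtain ⟨h, hh, f, hf, hhf⟩ := mem_closure_iff.1
      (hdense' (continuous_const (y := (1 : ℝ)))) {h : Ybar → ℝ | h z ≠ 0}
      (isOpen_ne.preimage (continuous_apply z)) one_ne_zero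
    have := (hhf z).trans (hzero f hf)
    exact hh (by exact_mod_cast this)
  have : Nonempty Xbar := ⟨(hSne (eY hY.some)).some⟩
  let Q : ℕ → Set Ybar := fun p =>
    {z | ∀ f ∈ EX, (∀ x, |f x| ≤ 1) → T z f ∈ Icc ((-(p : ℝ) : ℝ) : EReal) ((p : ℝ) : EReal)}
  have hQclosed : ∀ p, IsClosed (Q p) := fun p => by
    simp only [Q, ofPred_forall]
    exact isClosed_iInter fun f => isClosed_iInter fun hf => isClosed_iInter fun _ =>
      isClosed_Icc.preimage (hTcont f hf)
  have hYfin : ∀ y, ∃ (A : Finset X) (p : ℕ), S (eY y) ⊆ eX '' A ∧ eY y ∈ Q p := fun y => by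
    obtain ⟨A, C, hAC⟩ := exists_finset_bound ((LinearMap.proj y : (Y → ℝ) →ₗ[ℝ] ℝ) ∘ₗ Φ)
      ((continuous_apply y).comp hΦcont)
    obtain ⟨p, hp⟩ := exists_nat_ge C
    refine ⟨A, p, fun w hw => ?_, fun f hf hf1 => ?_⟩
    · by_contra hwA
      obtain ⟨f, hf, hfU, hne⟩ := hw _
        ((A.finite_toSet.image eX).isClosed.isOpen_compl.mem_nhds hwA)
      refine hne ?_
      rw [hTY f hf y, EReal.coe_eq_zero]
      exact eq_zero_of_finset_bound hAC (f := ⟨f, hspan f hf⟩) fun x hx =>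
        hfU x fun h => h ⟨x, hx, rfl⟩
    · rw [hTY f hf y]
      have := abs_le.1 ((hAC ⟨f, hspan f hf⟩ fun x _ => hf1 x).trans hp)
      exact ⟨EReal.coe_le_coe_iff.2 this.1, EReal.coe_le_coe_iff.2 this.2⟩
  have hpiece : ∀ (n p : ℕ) (U : Fin n → Set Xbar), (∀ i, IsOpen (U i)) →
      Pairwise (Function.onFun Disjoint U) → ∀ C : Set Ybar, IsClosed C →
      (∀ z ∈ C, (S z).encard ≤ n) → (∀ z ∈ C, ∀ i, (S z ∩ U i).Nonempty) → C ⊆ Q p →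
      P ↥(eY ⁻¹' C) := by
    intro n p U hU hdisj C hC hCn hCU hCQ
    have := isCompact_iff_compactSpace.1 hC.isCompact
    have : SecondCountableTopology Y := heY.secondCountableTopology
    obtain ⟨σ, hσ, hσS⟩ := exists_continuous_selection hSopen hU hdisj hCn hCU
    have hsub : ∀ y, S (eY y) ⊆ range eX := fun y => by
      obtain ⟨A, -, hA, -⟩ := hYfin y
      exact hA.trans (image_subset_range _ _)
    refine hP.of_finite_fibers_over (W := {w | ∀ i, w i ∈ range eX}) hσ
      (hP.subset _ (hP.pi_fin hXbarP n) _) (fun w hw => ?_)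
      (j := fun y : ↥(eY ⁻¹' C) => (⟨eY y, y.2⟩ : C))
      (IsEmbedding.of_comp ((heY.continuous.comp continuous_subtype_val).subtype_mk _)
        continuous_subtype_val (heY.comp .subtypeVal)) fun y i => ?_
    · classical
      choose x hx using hw
      refine Finite.subset ((finite_setOf_functionalSupport_eq heX.isInducing hEXqs hBbasis hPU'
        hUry hT hdense' p (Finset.univ.image x)).preimage Subtype.val_injective.injOn)
        fun z hz => ⟨hCQ z.2, ?_⟩
      change S z = _
      rw [hσS z, show σ z = w from hz, Finset.coe_image, Finset.coe_univ, image_univ,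
        ← range_comp]
      exact congrArg range (funext fun i => (hx i).symm)
    · exact hsub y (hσS ⟨eY y, y.2⟩ ▸ mem_range_self i)
  have hFσ : ∀ (n : ℕ) (U : Fin n → B), ∃ F : ℕ → Set Ybar, (∀ k, IsClosed (F k)) ∧
      ⋃ k, F k = {z | ∀ i, (S z ∩ U i).Nonempty} := fun n U => by
    let := metrizableSpaceMetric Ybar
    have hO : IsOpen {z | ∀ i, (S z ∩ U i).Nonempty} := by
      simp only [ofPred_forall]
      exact isOpen_iInter_of_finite fun i => hSopen _ (hBbasis.isOpen (U i).2)
    obtain ⟨F, hF, -, hFU, -⟩ := hO.exists_iUnion_isClosed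
    exact ⟨F, hF, hFU⟩
  choose F hFclosed hFU using hFσ
  have := hBcount.to_subtype
  let ι := {i : (Σ n : ℕ, Fin n → B) × ℕ × ℕ //
    Pairwise (Function.onFun Disjoint fun k => (i.1.2 k : Set Xbar))}
  have : Nonempty ι := ⟨⟨(⟨0, finZeroElim⟩, 0, 0), fun i => i.elim0⟩⟩
  let C : ι → Set Ybar := fun i =>
    {z | (S z).encard ≤ i.1.1.1} ∩ Q i.1.2.1 ∩ F i.1.1.1 i.1.1.2 i.1.2.2
  have hC : ∀ i, IsClosed (C i) := fun i =>
    ((isClosed_encard_le hSopen _).inter (hQclosed _)).inter (hFclosed _ _ _)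
  refine hP.of_countable_closed_cover (fun i => eY ⁻¹' C i)
    (fun i => (hC i).preimage heY.continuous) (fun i => ?_) (eq_univ_of_forall fun y => ?_)
  · refine hpiece i.1.1.1 i.1.2.1 (fun k => i.1.1.2 k) (fun k => hBbasis.isOpen (i.1.1.2 k).2)
      i.2 _ (hC i) (fun z hz => hz.1.1) (fun z hz => ?_) fun z hz => hz.1.2
    have := mem_iUnion_of_mem _ hz.2
    rwa [hFU] at this
  · obtain ⟨A, p, hA, hp⟩ := hYfin y
    have hfin : (S (eY y)).Finite := (A.finite_toSet.image eX).subset hA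
    obtain ⟨V, hV, hVdisj⟩ := hfin.t2_separation
    have := hfin.to_subtype
    obtain ⟨n, ⟨g⟩⟩ := Finite.exists_equiv_fin (S (eY y))
    choose U hUB hxU hUV using fun i : Fin n =>
      hBbasis.exists_subset_of_mem_open (hV (g.symm i)).1 (hV (g.symm i)).2
    have hmem : eY y ∈ ⋃ k, F n (fun i => ⟨U i, hUB i⟩) k := by
      rw [hFU]
      exact fun i => ⟨_, (g.symm i).2, hxU i⟩
    obtain ⟨k, hk⟩ := mem_iUnion.1 hmem
    refine mem_iUnion.2 ⟨⟨(⟨n, fun i => ⟨U i, hUB i⟩⟩, p, k), fun i j hij => ?_⟩, ⟨?_, hp⟩, hk⟩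
    · exact (hVdisj (g.symm i).2 (g.symm j).2
        fun h => hij (g.symm.injective (Subtype.ext h))).mono (hUV i) (hUV j)
    · change (S (eY y)).encard ≤ n
      rw [← ENat.card_coe_set_eq, ENat.card_congr g]
      simp
end

section
/- Let Y be a Tychonoff space with Čech–Stone compactification βY. For every countable set Φ′ ⊆ C(βY, [−∞, ∞]) there is a countable set Φ ⊆ C(βY, [−∞, ∞]) containing Φ′ such that (△Φ)(βY) is homeomorphic to (△Φ′)(βY) and the set of real-valued elements of E_Φ = { π_ḡ : ḡ ∈ Φ } is dense in C_p((△Φ)(βY)). -/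
open Set Topology TopologicalSpace

universe u

/-- The diagonal product of a family `Φ` of `[-∞,∞]`-valued maps on `Z`:
`z ↦ (g z)_{g ∈ Φ}`, so that `(△Φ)(Z) = Set.range (diagProd Φ)`. -/
def diagProd {Z : Type u} (Φ : Set (Z → EReal)) : Z → (Φ → EReal) :=
  fun z g => (g : Z → EReal) z

theorem continuous_diagProd {Z : Type u} [TopologicalSpace Z] {Φ : Set (Z → EReal)}
    (hΦ : ∀ g ∈ Φ, Continuous g) : Continuous (diagProd Φ) :=
  continuous_pi fun g => hΦ g g.2

/-- The restriction of coordinates `(△Φ)(Z) → (△Ψ)(Z)` for `Ψ ⊆ Φ`. -/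
def diagProdRestrict {Z : Type u} {Ψ Φ : Set (Z → EReal)} (h : Ψ ⊆ Φ) :
    Set.range (diagProd Φ) → Set.range (diagProd Ψ) :=
  fun x => ⟨fun g => x.1 ⟨g, h g.2⟩, by
    obtain ⟨_, z, rfl⟩ := x
    exact ⟨z, rfl⟩⟩

theorem continuous_diagProdRestrict {Z : Type u} {Ψ Φ : Set (Z → EReal)} (h : Ψ ⊆ Φ) :
    Continuous (diagProdRestrict h) := by
  refine continuous_induced_rng.mpr (continuous_pi fun g => ?_)
  exact (continuous_apply (⟨g, h g.2⟩ : Φ)).comp continuous_subtype_val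

theorem diagProdRestrict_bijective {Z : Type u} {Ψ Φ : Set (Z → EReal)} (h : Ψ ⊆ Φ)
    (hfactor : ∀ g ∈ Φ, ∀ z w, diagProd Ψ z = diagProd Ψ w → g z = g w) :
    Function.Bijective (diagProdRestrict h) := by
  constructor
  · rintro ⟨_, z, rfl⟩ ⟨_, w, rfl⟩ hzw
    have hzw' : diagProd Ψ z = diagProd Ψ w := congrArg Subtype.val hzw
    exact Subtype.ext (funext fun g => hfactor g g.2 z w hzw')
  · rintro ⟨_, z, rfl⟩
    exact ⟨⟨_, z, rfl⟩, rfl⟩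

/-- If `Z` is compact and every member of `Φ` factors through `△Ψ`, then the restriction of
coordinates is a homeomorphism. -/
noncomputable def diagProdHomeomorph {Z : Type u} [TopologicalSpace Z] [CompactSpace Z]
    {Ψ Φ : Set (Z → EReal)} (h : Ψ ⊆ Φ) (hΦ : ∀ g ∈ Φ, Continuous g)
    (hfactor : ∀ g ∈ Φ, ∀ z w, diagProd Ψ z = diagProd Ψ w → g z = g w) :
    Set.range (diagProd Φ) ≃ₜ Set.range (diagProd Ψ) :=
  haveI : CompactSpace (Set.range (diagProd Φ)) :=
    isCompact_iff_compactSpace.mp (isCompact_range (continuous_diagProd hΦ))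
  Continuous.homeoOfEquivCompactToT2
    (f := Equiv.ofBijective _ (diagProdRestrict_bijective h hfactor))
    (continuous_diagProdRestrict h)

theorem statement9 {Y : Type u} [TopologicalSpace Y] [T35Space Y]
    (Φ' : Set (StoneCech Y → EReal)) (hΦ'count : Φ'.Countable)
    (hΦ'cont : ∀ g ∈ Φ', Continuous g) :
    ∃ Φ : Set (StoneCech Y → EReal), Φ.Countable ∧ (∀ g ∈ Φ, Continuous g) ∧ Φ' ⊆ Φ ∧
      -- `(△Φ)(βY)` is homeomorphic to `(△Φ')(βY)`
      Nonempty (↥(Set.range (diagProd Φ)) ≃ₜ ↥(Set.range (diagProd Φ'))) ∧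
      -- the set of real-valued elements of `E_Φ = {π_ḡ : ḡ ∈ Φ}` is dense in
      -- `C_p((△Φ)(βY))`
      {h : ↥(Set.range (diagProd Φ)) → ℝ | Continuous h} ⊆
        closure {h : ↥(Set.range (diagProd Φ)) → ℝ |
          ∃ g : Φ, ∀ z : ↥(Set.range (diagProd Φ)), (h z : EReal) = (z : Φ → EReal) g} := by
  have : Countable Φ' := hΦ'count.to_subtype
  have hcont := continuous_diagProd hΦ'cont
  have : CompactSpace (Set.range (diagProd Φ')) :=
    isCompact_iff_compactSpace.mp (isCompact_range hcont)
  obtain ⟨D, hDcount, hDdense⟩ := exists_countable_dense C(Set.range (diagProd Φ'), ℝ)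
  let lift : C(Set.range (diagProd Φ'), ℝ) → StoneCech Y → EReal :=
    fun d z => (d ⟨diagProd Φ' z, z, rfl⟩ : ℝ)
  have hsub : Φ' ⊆ Φ' ∪ lift '' D := subset_union_left
  have hΦcont : ∀ g ∈ Φ' ∪ lift '' D, Continuous g := by
    rintro g (hg | ⟨d, -, rfl⟩)
    · exact hΦ'cont g hg
    · exact continuous_coe_real_ereal.comp (d.continuous.comp (hcont.subtype_mk _))
  have hfactor : ∀ g ∈ Φ' ∪ lift '' D, ∀ z w,
      diagProd Φ' z = diagProd Φ' w → g z = g w := by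
    rintro g (hg | ⟨d, -, rfl⟩) z w hzw
    · exact congrFun hzw ⟨g, hg⟩
    · simp only [lift, hzw]
  let e := diagProdHomeomorph hsub hΦcont hfactor
  refine ⟨Φ' ∪ lift '' D, hΦ'count.union (hDcount.image _), hΦcont, hsub, ⟨e⟩, ?_⟩
  intro h hh
  let F : C(Set.range (diagProd Φ'), ℝ) → Set.range (diagProd (Φ' ∪ lift '' D)) → ℝ :=
    fun f x => f (e x)
  have hF : Continuous F := continuous_pi fun x => continuous_eval_const (e x)
  have hFh : F ⟨h ∘ e.symm, Continuous.comp hh e.symm.continuous⟩ = h := by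
    ext x
    simp [F]
  rw [← hFh]
  refine closure_mono ?_ (image_closure_subset_closure_image hF ⟨_, hDdense _, rfl⟩)
  rintro _ ⟨d, hd, rfl⟩
  refine ⟨⟨lift d, Or.inr ⟨d, hd, rfl⟩⟩, ?_⟩
  rintro ⟨_, z, rfl⟩
  rfl
end
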